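/- Let 1 < p ≤ 3/2 and g(u) = |u|^{p−1}u. For each ℓ > 0 let u_ℓ be the unique nonnegative weak solution on Q^∞ = (0,∞)×(0,∞) of u_t − u_{xx} = 0 with boundary flux measure μ = ℓ δ₀ (Dirac mass at t = 0) and initial measure ν = 0, taken with its representative continuous on (0,∞)×[0,∞). Then the family ℓ ↦ u_ℓ is nondecreasing and u_ℓ tends to infinity as ℓ → ∞: for every t > 0 and x ≥ 0, lim_{ℓ→∞} u_ℓ(t,x) = +∞. -/

import Mathlib

open MeasureTheory Real Set Filter Topology

/-- The class `𝕏(Q^∞)` of test functions: `C¹` in `t`, `C²` in `x`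
(here realized as `C²` jointly), compactly supported in `[0,∞)×[0,∞)`,
with `ζ_x(t,0) = 0` for all `t`. -/
def IsTestFunInf (ζ : ℝ → ℝ → ℝ) : Prop :=
  ContDiff ℝ 2 (fun q : ℝ × ℝ => ζ q.1 q.2) ∧
  HasCompactSupport (fun q : ℝ × ℝ => ζ q.1 q.2) ∧
  ∀ t : ℝ, deriv (ζ t) 0 = 0

/-- `u` is a weak solution on `Q^∞ = (0,∞)×(0,∞)` of `u_t − u_{xx} = 0` with
boundary flux measure `μ = ℓ δ₀` (for `g(u) = |u|^{p−1}u`) and initial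
measure `ν = 0`. -/
def IsWeakSolDelta (p ℓ : ℝ) (u : ℝ → ℝ → ℝ) : Prop :=
  LocallyIntegrableOn (fun q : ℝ × ℝ => u q.1 q.2) (Ici 0 ×ˢ Ici 0) volume ∧
  LocallyIntegrableOn (fun t => u t 0) (Ioi 0) volume ∧
  LocallyIntegrableOn (fun t => |u t 0| ^ (p - 1) * u t 0) (Ioi 0) volume ∧
  ∀ ζ : ℝ → ℝ → ℝ, IsTestFunInf ζ →
    -(∫ t in Ioi (0:ℝ), ∫ x in Ioi (0:ℝ),
        (deriv (fun s => ζ s x) t + deriv (deriv (ζ t)) x) * u t x)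
      + (∫ t in Ioi (0:ℝ), |u t 0| ^ (p - 1) * u t 0 * ζ t 0)
    = ℓ * ζ 0 0


/-- The weak identity with a general boundary density `f`. -/
def WeakId (ℓ : ℝ) (u : ℝ → ℝ → ℝ) (f : ℝ → ℝ) : Prop :=
  ∀ ζ : ℝ → ℝ → ℝ, IsTestFunInf ζ →
    -(∫ t in Ioi (0:ℝ), ∫ x in Ioi (0:ℝ),
        (deriv (fun s => ζ s x) t + deriv (deriv (ζ t)) x) * u t x)
      + (∫ t in Ioi (0:ℝ), f t * ζ t 0)
    = ℓ * ζ 0 0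

/-- Admissible spatially compact test functions before time `A`. -/
structure Adm (A R : ℝ) (ψ ψs ψy ψyy : ℝ → ℝ → ℝ) : Prop where
  smooth : ContDiffOn ℝ 2 (fun q : ℝ × ℝ => ψ q.1 q.2) (Iio A ×ˢ univ)
  ds : ∀ s < A, ∀ y, HasDerivAt (fun s => ψ s y) (ψs s y) s
  dy : ∀ s < A, ∀ y, HasDerivAt (ψ s) (ψy s y) y
  dyy : ∀ s < A, ∀ y, HasDerivAt (ψy s) (ψyy s y) y
  cont : ContinuousOn (fun q : ℝ × ℝ => ψs q.1 q.2 + ψyy q.1 q.2) (Iio A ×ˢ univ)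
  supp : ∀ s < A, ∀ y, R < |y| → ψ s y = 0
  even : ∀ s < A, ψy s 0 = 0

lemma Adm.supp_s {A R : ℝ} {ψ ψs ψy ψyy : ℝ → ℝ → ℝ} (h : Adm A R ψ ψs ψy ψyy) {s y : ℝ}
    (hs : s < A) (hy : R < |y|) : ψs s y = 0 := by
  refine (h.ds s hs y).unique ((hasDerivAt_const s (0:ℝ)).congr_of_eventuallyEq ?_)
  filter_upwards [Iio_mem_nhds hs] with t ht using h.supp t ht y hy

lemma Adm.supp_y {A R : ℝ} {ψ ψs ψy ψyy : ℝ → ℝ → ℝ} (h : Adm A R ψ ψs ψy ψyy) {s y : ℝ}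
    (hs : s < A) (hy : R < |y|) : ψy s y = 0 := by
  refine (h.dy s hs y).unique ((hasDerivAt_const y (0:ℝ)).congr_of_eventuallyEq ?_)
  have : {z : ℝ | R < |z|} ∈ 𝓝 y := (isOpen_lt continuous_const continuous_abs).mem_nhds hy
  filter_upwards [this] with t ht using h.supp s hs t ht

lemma Adm.supp_yy {A R : ℝ} {ψ ψs ψy ψyy : ℝ → ℝ → ℝ} (h : Adm A R ψ ψs ψy ψyy) {s y : ℝ}
    (hs : s < A) (hy : R < |y|) : ψyy s y = 0 := by
  refine (h.dyy s hs y).unique ((hasDerivAt_const y (0:ℝ)).congr_of_eventuallyEq ?_)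
  have : {z : ℝ | R < |z|} ∈ 𝓝 y := (isOpen_lt continuous_const continuous_abs).mem_nhds hy
  filter_upwards [this] with t ht using h.supp_y hs ht

lemma cont_par {u ψ : ℝ → ℝ → ℝ} {A R : ℝ}
    (hc : ContinuousOn (fun q : ℝ × ℝ => u q.1 q.2) (Ioi 0 ×ˢ Ici 0))
    (hψ : ContinuousOn (fun q : ℝ × ℝ => ψ q.1 q.2) (Iio A ×ˢ univ))
    (hs : ∀ s < A, ∀ y, R < |y| → ψ s y = 0) :
    ContinuousOn (fun s => ∫ y in Ioi (0:ℝ), ψ s y * u s y) (Ioo 0 A) := by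
  have h1 : ContinuousOn (fun s => ∫ y in Ioi (0:ℝ), ψ s y * u s (max y 0)) (Ioo 0 A) := by
    refine continuousOn_integral_of_compact_support (k := Icc (-R) R) isCompact_Icc ?_ ?_
    · refine ContinuousOn.mul (hψ.mono ?_) ?_
      · rintro ⟨a, b⟩ ⟨ha, -⟩
        exact ⟨ha.2, trivial⟩
      · refine hc.comp (f := fun q : ℝ × ℝ => (q.1, max q.2 0)) (by fun_prop) ?_
        rintro ⟨a, b⟩ ⟨ha, -⟩
        exact ⟨ha.1, mem_Ici.2 (le_max_right _ _)⟩
    · intro s y hs' hy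
      rw [hs s hs'.2 y, zero_mul]
      by_contra hcon
      exact hy (abs_le.1 (not_lt.1 hcon))
  refine h1.congr fun s hs' => ?_
  refine setIntegral_congr_fun measurableSet_Ioi fun y hy => ?_
  simp only [max_eq_left (le_of_lt (mem_Ioi.1 hy))]

lemma int_prod {u ψ : ℝ → ℝ → ℝ} {A R b : ℝ} (hb : b < A)
    (hloc : LocallyIntegrableOn (fun q : ℝ × ℝ => u q.1 q.2) (Ici 0 ×ˢ Ici 0) volume)
    (hψ : ContinuousOn (fun q : ℝ × ℝ => ψ q.1 q.2) (Iio A ×ˢ univ))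
    (hs : ∀ s < A, ∀ y, R < |y| → ψ s y = 0) :
    Integrable (fun q : ℝ × ℝ => ψ q.1 q.2 * u q.1 q.2)
      ((volume.restrict (Ioc 0 b)).prod (volume.restrict (Ioi 0))) := by
  rw [Measure.prod_restrict, ← Measure.volume_eq_prod]
  have hK : IsCompact (Icc (0:ℝ) b ×ˢ Icc (0:ℝ) R) := isCompact_Icc.prod isCompact_Icc
  have h1 : IntegrableOn (fun q : ℝ × ℝ => ψ q.1 q.2 * u q.1 q.2) (Icc (0:ℝ) b ×ˢ Icc (0:ℝ) R) := by
    refine IntegrableOn.continuousOn_mul (hψ.mono ?_) (hloc.integrableOn_compact_subset ?_ hK) hK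
    · rintro ⟨x, y⟩ ⟨hx, hy⟩
      exact ⟨lt_of_le_of_lt hx.2 hb, trivial⟩
    · rintro ⟨x, y⟩ ⟨hx, hy⟩
      exact ⟨hx.1, hy.1⟩
  refine h1.of_forall_sdiff_eq_zero (measurableSet_Ioc.prod measurableSet_Ioi) ?_
  rintro ⟨x, y⟩ ⟨⟨hx, hy⟩, hn⟩
  have hx2 : x ≤ b := hx.2
  have hx1 : 0 < x := hx.1
  have hy1 : 0 < y := hy
  simp only
  rw [hs x (lt_of_le_of_lt hx2 hb) y, zero_mul]
  rw [abs_of_pos hy1]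
  by_contra hcon
  exact hn ⟨⟨hx1.le, hx2⟩, ⟨hy1.le, not_lt.1 hcon⟩⟩

lemma int_s {u ψ : ℝ → ℝ → ℝ} {A R b : ℝ} (hb : b < A)
    (hloc : LocallyIntegrableOn (fun q : ℝ × ℝ => u q.1 q.2) (Ici 0 ×ˢ Ici 0) volume)
    (hψ : ContinuousOn (fun q : ℝ × ℝ => ψ q.1 q.2) (Iio A ×ˢ univ))
    (hs : ∀ s < A, ∀ y, R < |y| → ψ s y = 0) :
    IntegrableOn (fun s => ∫ y in Ioi (0:ℝ), ψ s y * u s y) (Ioc 0 b) :=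
  (int_prod hb hloc hψ hs).integral_prod_left

lemma int_y {u ψ : ℝ → ℝ → ℝ} {A R s : ℝ} (hs0 : 0 < s) (hsA : s < A)
    (hc : ContinuousOn (fun q : ℝ × ℝ => u q.1 q.2) (Ioi 0 ×ˢ Ici 0))
    (hψ : ContinuousOn (fun q : ℝ × ℝ => ψ q.1 q.2) (Iio A ×ˢ univ))
    (hs : ∀ s < A, ∀ y, R < |y| → ψ s y = 0) :
    IntegrableOn (fun y => ψ s y * u s y) (Ioi 0) := by
  have h1 : IntegrableOn (fun y => ψ s y * u s y) (Icc 0 R) := by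
    refine ContinuousOn.integrableOn_Icc ?_
    refine ContinuousOn.mul ?_ ?_
    · exact hψ.comp (f := fun y : ℝ => (s, y)) (by fun_prop) fun y _ => ⟨hsA, trivial⟩
    · exact hc.comp (f := fun y : ℝ => (s, y)) (by fun_prop) fun y hy => ⟨hs0, hy.1⟩
  refine h1.of_forall_sdiff_eq_zero measurableSet_Ioi ?_
  rintro y ⟨hy, hn⟩
  have hy1 : 0 < y := hy
  rw [hs s hsA y, zero_mul]
  rw [abs_of_pos hy1]
  by_contra hcon
  exact hn ⟨hy1.le, not_lt.1 hcon⟩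


lemma adm_test {A R b : ℝ} {ψ ψs ψy ψyy : ℝ → ℝ → ℝ} (h : Adm A R ψ ψs ψy ψyy) (hb : b < A)
    {θ : ℝ → ℝ} (hθ : ContDiff ℝ 2 θ) (hθ1 : ∀ s, b ≤ s → θ s = 0) (hθ2 : ∀ s ≤ -2, θ s = 0) :
    IsTestFunInf (fun s y => θ s * ψ s y) := by
  refine ⟨?_, ?_, ?_⟩
  · rw [contDiff_iff_contDiffAt]
    rintro ⟨s, y⟩
    by_cases hs : s < A
    · refine ContDiffAt.mul (hθ.comp contDiff_fst).contDiffAt ?_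
      exact h.smooth.contDiffAt ((isOpen_Iio.prod isOpen_univ).mem_nhds ⟨hs, trivial⟩)
    · have hs' : b < s := lt_of_lt_of_le hb (not_lt.1 hs)
      refine (contDiffAt_const (c := (0:ℝ))).congr_of_eventuallyEq ?_
      have : Ioi b ×ˢ (univ : Set ℝ) ∈ 𝓝 (s, y) :=
        (isOpen_Ioi.prod isOpen_univ).mem_nhds ⟨hs', trivial⟩
      filter_upwards [this] with q hq
      rw [hθ1 q.1 (le_of_lt hq.1), zero_mul]
  · refine HasCompactSupport.intro (K := Icc (-2) b ×ˢ Icc (-R) R)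
      (isCompact_Icc.prod isCompact_Icc) ?_
    rintro ⟨s, y⟩ hq
    simp only
    by_cases h1 : b ≤ s
    · rw [hθ1 s h1, zero_mul]
    by_cases h2 : s ≤ -2
    · rw [hθ2 s h2, zero_mul]
    rw [h.supp s (by linarith) y, mul_zero]
    by_contra hcon
    exact hq ⟨⟨by linarith, by linarith⟩, abs_le.1 (not_lt.1 hcon)⟩
  · intro s
    by_cases hs : s < A
    · have := ((h.dy s hs 0).const_mul (θ s)).deriv
      rw [h.even s hs, mul_zero] at this
      exact this
    · have : (fun y => θ s * ψ s y) = fun _ => 0 := by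
        funext y
        rw [hθ1 s (by linarith), zero_mul]
      change deriv (fun y => θ s * ψ s y) 0 = 0
      rw [this]; simp

lemma weak_theta {ℓ : ℝ} {u : ℝ → ℝ → ℝ} {f : ℝ → ℝ} (hw : WeakId ℓ u f)
    {A R b : ℝ} {ψ ψs ψy ψyy : ℝ → ℝ → ℝ} (h : Adm A R ψ ψs ψy ψyy) (hb : b < A)
    {θ : ℝ → ℝ} (hθ : ContDiff ℝ 2 θ) (hθ1 : ∀ s, b ≤ s → θ s = 0) (hθ2 : ∀ s ≤ -2, θ s = 0) :
    -(∫ s in Ioc (0:ℝ) b, ∫ y in Ioi (0:ℝ),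
        (deriv θ s * ψ s y + θ s * (ψs s y + ψyy s y)) * u s y)
      + (∫ s in Ioc (0:ℝ) b, f s * (θ s * ψ s 0)) = ℓ * (θ 0 * ψ 0 0) := by
  have hd1 : ∀ s, b < s → deriv θ s = 0 := by
    intro s hs
    refine ((hasDerivAt_const s (0:ℝ)).congr_of_eventuallyEq ?_).deriv
    filter_upwards [Ioi_mem_nhds hs] with t ht using hθ1 t (le_of_lt ht)
  have := hw _ (adm_test h hb hθ hθ1 hθ2)
  rw [← this]
  congr 1
  · congr 1
    have e1 : ∀ s ∈ Ioc (0:ℝ) b, (∫ y in Ioi (0:ℝ),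
        (deriv θ s * ψ s y + θ s * (ψs s y + ψyy s y)) * u s y) =
        ∫ x in Ioi (0:ℝ), (deriv (fun s => θ s * ψ s x) s +
          deriv (deriv (fun y => θ s * ψ s y)) x) * u s x := by
      intro s hs
      have hsA : s < A := lt_of_le_of_lt hs.2 hb
      refine integral_congr_ae (Eventually.of_forall fun y => ?_)
      have h1 : deriv (fun s => θ s * ψ s y) s = deriv θ s * ψ s y + θ s * ψs s y :=
        (((hθ.differentiable (by norm_num)).differentiableAt.hasDerivAt).mul (h.ds s hsA y)).deriv
      have h2 : deriv (fun y => θ s * ψ s y) = fun y => θ s * ψy s y := by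
        funext z
        exact ((h.dy s hsA z).const_mul (θ s)).deriv
      have h3 : deriv (deriv (fun y => θ s * ψ s y)) y = θ s * ψyy s y := by
        rw [h2]
        exact ((h.dyy s hsA y).const_mul (θ s)).deriv
      simp only [h1, h3]
      ring
    rw [setIntegral_congr_fun measurableSet_Ioc e1]
    refine setIntegral_eq_of_subset_of_forall_sdiff_eq_zero measurableSet_Ioi
      (fun x hx => hx.1) ?_ |>.symm
    rintro s ⟨hs, hns⟩
    have hbs : b < s := by
      by_contra hcon
      exact hns ⟨hs, not_lt.1 hcon⟩
    have z1 : ∀ x, deriv (fun s => θ s * ψ s x) s = 0 := by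
      intro x
      refine ((hasDerivAt_const s (0:ℝ)).congr_of_eventuallyEq ?_).deriv
      filter_upwards [Ioi_mem_nhds hbs] with t ht
      rw [hθ1 t (le_of_lt ht), zero_mul]
    simp [z1, hθ1 s hbs.le]
  · refine setIntegral_eq_of_subset_of_forall_sdiff_eq_zero measurableSet_Ioi
      (fun x hx => hx.1) ?_ |>.symm
    rintro s ⟨hs, hns⟩
    have hbs : b < s := by
      by_contra hcon
      exact hns ⟨hs, not_lt.1 hcon⟩
    simp [hθ1 s hbs.le]

lemma exists_theta {A : ℝ} (hA : 0 < A) {φ : ℝ → ℝ} (hφ : ContDiff ℝ (⊤:ℕ∞) φ)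
    (hφs : HasCompactSupport φ) (hφA : tsupport φ ⊆ Ioo 0 A) :
    ∃ θ : ℝ → ℝ, ∃ b, 0 < b ∧ b < A ∧ ContDiff ℝ 2 θ ∧ (∀ s, b ≤ s → θ s = 0) ∧
      (∀ s, b ≤ s → φ s = 0) ∧ (∀ s ≤ 0, φ s = 0) ∧
      (∀ s ≤ -2, θ s = 0) ∧ (∀ s, 0 ≤ s → HasDerivAt θ (- φ s) s) ∧ θ 0 = ∫ s in 0..b, φ s := by
  obtain ⟨b, hb0, hbA, hb⟩ : ∃ b, 0 < b ∧ b < A ∧ ∀ s, b ≤ s → φ s = 0 := by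
    rcases (tsupport φ).eq_empty_or_nonempty with he | hne
    · have : φ = 0 := tsupport_eq_empty_iff.1 he
      exact ⟨A/2, by positivity, by linarith, by simp [this]⟩
    · obtain ⟨m, hm, hmax⟩ := hφs.isCompact.exists_isGreatest hne
      have := hφA hm
      refine ⟨(m + A)/2, by linarith [this.1, this.2], by linarith [this.2], ?_⟩
      intro s hs
      by_contra hcon
      have := hmax (subset_tsupport φ hcon)
      linarith [(hφA hm).2]
  have hφ0 : ∀ s ≤ 0, φ s = 0 := by
    intro s hs
    by_contra hcon
    have := (hφA (subset_tsupport φ hcon)).1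
    linarith
  have hcφ : Continuous φ := hφ.continuous
  have hdP : ∀ s, HasDerivAt (fun s => ∫ t in s..b, φ t) (-φ s) s := fun s =>
    intervalIntegral.integral_hasDerivAt_left (hcφ.intervalIntegrable _ _)
      hcφ.stronglyMeasurable.stronglyMeasurableAtFilter hcφ.continuousAt
  have hP : ContDiff ℝ 2 (fun s => ∫ t in s..b, φ t) := by
    have : (2 : WithTop ℕ∞) = 1 + 1 := by norm_num
    rw [this, contDiff_succ_iff_deriv]
    refine ⟨fun s => (hdP s).differentiableAt, by simp, ?_⟩
    have : deriv (fun s => ∫ t in s..b, φ t) = fun s => - φ s := funext fun s => (hdP s).deriv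
    rw [this]
    exact (hφ.of_le (by exact_mod_cast le_top)).neg
  refine ⟨fun s => Real.smoothTransition (s + 2) * ∫ t in s..b, φ t, b, hb0, hbA,
    ?_, ?_, hb, hφ0, ?_, ?_, ?_⟩
  · exact ((Real.smoothTransition.contDiff (n := 2)).comp (contDiff_id.add contDiff_const)).mul hP
  · intro s hs
    have : ∫ t in s..b, φ t = 0 := by
      rw [intervalIntegral.integral_symm, intervalIntegral.integral_congr (g := fun _ => 0)]
      · simp
      · intro t ht
        rw [uIcc_of_le hs] at ht
        exact hb t ht.1
    simp [this]
  · intro s hs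
    simp only
    rw [Real.smoothTransition.zero_of_nonpos (by linarith), zero_mul]
  · intro s hs
    refine (hdP s).congr_of_eventuallyEq ?_
    filter_upwards [Ioi_mem_nhds (show (-1:ℝ) < s by linarith)] with t ht
    rw [Real.smoothTransition.one_of_one_le (by linarith [mem_Ioi.1 ht]), one_mul]
  · simp only [zero_add]
    rw [Real.smoothTransition.one_of_one_le (by norm_num), one_mul]


lemma weak_time {ℓ : ℝ} {u : ℝ → ℝ → ℝ} {f : ℝ → ℝ} (hw : WeakId ℓ u f)
    (hloc : LocallyIntegrableOn (fun q : ℝ × ℝ => u q.1 q.2) (Ici 0 ×ˢ Ici 0) volume)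
    (hc : ContinuousOn (fun q : ℝ × ℝ => u q.1 q.2) (Ioi 0 ×ˢ Ici 0))
    (hfc : ContinuousOn f (Ioi 0)) (hfi : ∀ T, IntegrableOn f (Ioc 0 T))
    {A R T : ℝ} {ψ ψs ψy ψyy : ℝ → ℝ → ℝ} (h : Adm A R ψ ψs ψy ψyy) (hT : 0 < T) (hTA : T < A) :
    (∫ y in Ioi (0:ℝ), ψ T y * u T y) + (∫ s in Ioc 0 T, f s * ψ s 0) =
      ℓ * ψ 0 0 + ∫ s in Ioc 0 T, ∫ y in Ioi (0:ℝ), (ψs s y + ψyy s y) * u s y := by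
  have hA : 0 < A := hT.trans hTA
  set m : ℝ → ℝ := fun s => ∫ y in Ioi (0:ℝ), ψ s y * u s y with hm
  set L : ℝ → ℝ := fun s => ∫ y in Ioi (0:ℝ), (ψs s y + ψyy s y) * u s y with hL
  have hψc := h.smooth.continuousOn
  have hLs : ∀ s < A, ∀ y, R < |y| → ψs s y + ψyy s y = 0 := fun s hs y hy => by
    rw [h.supp_s hs hy, h.supp_yy hs hy, add_zero]
  have hmc : ContinuousOn m (Ioo 0 A) := cont_par hc hψc h.supp
  have hLc : ContinuousOn L (Ioo 0 A) :=
    cont_par (ψ := fun s y => ψs s y + ψyy s y) hc h.cont hLs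
  have hLi : ∀ b < A, IntegrableOn L (Ioc 0 b) := fun b hb =>
    int_s (ψ := fun s y => ψs s y + ψyy s y) hb hloc h.cont hLs
  have hmi : ∀ b < A, IntegrableOn m (Ioc 0 b) := fun b hb => int_s hb hloc hψc h.supp
  have hψ0 : ContinuousOn (fun s => ψ s 0) (Iio A) :=
    hψc.comp (f := fun s : ℝ => (s, (0:ℝ))) (by fun_prop) fun s hs => ⟨hs, trivial⟩
  have hfψi : ∀ b < A, IntegrableOn (fun s => f s * ψ s 0) (Ioc 0 b) := fun b hb => by
    have h1 : IntegrableOn f (Icc 0 b) := by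
      rw [integrableOn_Icc_iff_integrableOn_Ioc]; exact hfi b
    exact (h1.mul_continuousOn (hψ0.mono fun s hs => lt_of_le_of_lt hs.2 hb)
      isCompact_Icc).mono_set Ioc_subset_Icc_self
  set r : ℝ → ℝ := fun s => L s - f s * ψ s 0 with hr
  have hrc : ContinuousOn r (Ioo 0 A) :=
    hLc.sub ((hfc.mono fun s hs => hs.1).mul (hψ0.mono fun s hs => hs.2))
  have hri : ∀ b < A, IntegrableOn r (Ioc 0 b) := fun b hb => (hLi b hb).sub (hfψi b hb)
  have hrI : ∀ b, 0 ≤ b → b < A → IntervalIntegrable r volume 0 b := fun b hb0 hb =>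
    (intervalIntegrable_iff_integrableOn_Ioc_of_le hb0).2 (hri b hb)
  set P : ℝ → ℝ := fun s => ∫ t in 0..s, r t with hP
  have hPd : ∀ s ∈ Ioo 0 A, HasDerivAt P (r s) s := fun s hs =>
    intervalIntegral.integral_hasDerivAt_right (hrI s hs.1.le hs.2)
      (hrc.stronglyMeasurableAtFilter isOpen_Ioo s hs) (hrc.continuousAt (isOpen_Ioo.mem_nhds hs))
  have hPc : ContinuousOn P (Ioo 0 A) := fun s hs => (hPd s hs).continuousAt.continuousWithinAt
  have hPc' : ∀ b, 0 ≤ b → b < A → ContinuousOn P (Icc 0 b) := fun b hb0 hb => by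
    have := intervalIntegral.continuousOn_primitive_interval' (hrI b hb0 hb) (a := 0) left_mem_uIcc
    rwa [uIcc_of_le hb0] at this
  -- key identity against smooth functions
  have key : ∀ φ : ℝ → ℝ, ContDiff ℝ (⊤:ℕ∞) φ → HasCompactSupport φ → tsupport φ ⊆ Ioo 0 A →
      ∫ s, φ s • (m s - P s - ℓ * ψ 0 0) = 0 := by
    intro φ hφ hφs hφA
    obtain ⟨θ, b, hb0, hbA, hθ, hθ1, hφ1, hφ0, hθ2, hθd, hθ0⟩ := exists_theta hA hφ hφs hφA
    have hW := weak_theta hw h hbA hθ hθ1 hθ2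
    have hθc : Continuous θ := hθ.continuous
    have hφc : Continuous φ := hφ.continuous
    have e1 : ∀ s ∈ Ioc (0:ℝ) b, (∫ y in Ioi (0:ℝ),
        (deriv θ s * ψ s y + θ s * (ψs s y + ψyy s y)) * u s y) = - (φ s * m s) + θ s * L s := by
      intro s hs
      have hsA : s < A := lt_of_le_of_lt hs.2 hbA
      rw [(hθd s hs.1.le).deriv]
      have i1 := int_y hs.1 hsA hc hψc h.supp
      have i2 := int_y (ψ := fun s y => ψs s y + ψyy s y) hs.1 hsA hc h.cont hLs
      have : ∀ y, (-φ s * ψ s y + θ s * (ψs s y + ψyy s y)) * u s y =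
          (-φ s) * (ψ s y * u s y) + θ s * ((ψs s y + ψyy s y) * u s y) := fun y => by ring
      simp only [this]
      rw [integral_add (i1.const_mul _) (i2.const_mul _), integral_const_mul, integral_const_mul]
      simp only [hm, hL]; ring
    rw [setIntegral_congr_fun measurableSet_Ioc e1] at hW
    have bI : ∀ {g k : ℝ → ℝ}, Continuous g → IntegrableOn k (Ioc 0 b) →
        IntegrableOn (fun s => g s * k s) (Ioc 0 b) := by
      intro g k hg hk
      have hk' : IntegrableOn k (Icc 0 b) := by
        rw [integrableOn_Icc_iff_integrableOn_Ioc]; exact hk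
      exact (hk'.continuousOn_mul hg.continuousOn isCompact_Icc).mono_set Ioc_subset_Icc_self
    have j1 := bI hφc (hmi b hbA)
    have j2 := bI hθc (hLi b hbA)
    have j3 := bI hθc (hfψi b hbA)
    have hsp : ∫ s in Ioc (0:ℝ) b, (-(φ s * m s) + θ s * L s) =
        (∫ s in Ioc (0:ℝ) b, -(φ s * m s)) + ∫ s in Ioc (0:ℝ) b, θ s * L s :=
      integral_add j1.neg j2
    rw [hsp] at hW
    have e2 : ∫ s in Ioc (0:ℝ) b, f s * (θ s * ψ s 0) = ∫ s in Ioc (0:ℝ) b, θ s * (f s * ψ s 0) := by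
      congr 1; funext s; ring
    rw [e2, integral_neg] at hW
    have e3 : ∫ s in Ioc (0:ℝ) b, θ s * r s = (∫ s in Ioc (0:ℝ) b, θ s * L s) -
        ∫ s in Ioc (0:ℝ) b, θ s * (f s * ψ s 0) := by
      rw [← integral_sub j2 j3]
      congr 1; funext s; simp only [hr]; ring
    have e4 : ∫ s in Ioc (0:ℝ) b, θ s * r s = ∫ s in Ioc (0:ℝ) b, φ s * P s := by
      rw [← intervalIntegral.integral_of_le hb0.le, ← intervalIntegral.integral_of_le hb0.le]
      rw [intervalIntegral.integral_mul_deriv_eq_deriv_mul_of_hasDerivAt (u := θ) (v := P)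
        (u' := fun s => -φ s) (v' := r) hθc.continuousOn]
      · simp [hθ1 b le_rfl, hP]
      · rw [uIcc_of_le hb0.le]; exact hPc' b hb0.le hbA
      · intro s hs
        rw [min_eq_left hb0.le] at hs
        exact hθd s hs.1.le
      · intro s hs
        rw [min_eq_left hb0.le, max_eq_right hb0.le] at hs
        exact hPd s ⟨hs.1, hs.2.trans hbA⟩
      · exact hφc.neg.intervalIntegrable _ _
      · exact hrI b hb0.le hbA
    have jP : IntegrableOn (fun s => φ s * P s) (Ioc 0 b) :=
      bI hφc (((hPc' b hb0.le hbA).integrableOn_Icc).mono_set Ioc_subset_Icc_self)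
    have jφ : IntegrableOn φ (Ioc 0 b) := (hφc.integrableOn_Icc).mono_set Ioc_subset_Icc_self
    have e5 : ∫ s, φ s • (m s - P s - ℓ * ψ 0 0) =
        ∫ s in Ioc (0:ℝ) b, (φ s * m s - φ s * P s - φ s * (ℓ * ψ 0 0)) := by
      rw [← setIntegral_eq_integral_of_forall_compl_eq_zero (s := Ioc 0 b)]
      · congr 1; funext s; simp only [smul_eq_mul]; ring
      · intro s hs
        have : φ s = 0 := by
          by_cases h0 : s ≤ 0
          · exact hφ0 s h0
          · refine hφ1 s ?_
            by_contra hcon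
            exact hs ⟨not_le.1 h0, (not_le.1 hcon).le⟩
        simp [this]
    have j6 : IntegrableOn (fun s => φ s * m s - φ s * P s) (Ioc 0 b) := j1.sub jP
    rw [e5, integral_sub j6 (jφ.mul_const _), integral_sub j1 jP, integral_mul_const,
      ← e4, e3]
    rw [hθ0, intervalIntegral.integral_of_le hb0.le] at hW
    linarith [hW]
  have hcont : ContinuousOn (fun s => m s - P s - ℓ * ψ 0 0) (Ioo 0 A) :=
    (hmc.sub hPc).sub continuousOn_const
  have hae := isOpen_Ioo.ae_eq_zero_of_integral_contDiff_smul_eq_zero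
    (hcont.locallyIntegrableOn measurableSet_Ioo) key
  have hae' : (fun s => m s - P s - ℓ * ψ 0 0) =ᵐ[volume.restrict (Ioo 0 A)] fun _ => 0 :=
    (ae_restrict_iff' measurableSet_Ioo).2 hae
  have := Measure.eqOn_open_of_ae_eq hae' isOpen_Ioo hcont continuousOn_const ⟨hT, hTA⟩
  simp only [hP] at this
  rw [intervalIntegral.integral_of_le hT.le, hr, integral_sub (hLi T hTA) (hfψi T hTA)] at this
  linarith

/-- integrability of the boundary flux near the initial time -/
lemma flux_int {ℓ : ℝ} {u : ℝ → ℝ → ℝ} {f : ℝ → ℝ} (hw : WeakId ℓ u f)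
    (hloc : LocallyIntegrableOn (fun q : ℝ × ℝ => u q.1 q.2) (Ici 0 ×ˢ Ici 0) volume)
    (hc : ContinuousOn (fun q : ℝ × ℝ => u q.1 q.2) (Ioi 0 ×ˢ Ici 0))
    (hfc : ContinuousOn f (Ioi 0)) {A R : ℝ}
    {ψ ψs ψy ψyy : ℝ → ℝ → ℝ} (h : Adm A R ψ ψs ψy ψyy) (hA : 0 < A) (h1 : ∀ s, 0 ≤ s → s < A → 0 < ψ s 0)
    (T : ℝ) : IntegrableOn f (Ioc 0 T) := by
  have hψc := h.smooth.continuousOn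
  have hLs : ∀ s < A, ∀ y, R < |y| → ψs s y + ψyy s y = 0 := fun s hs y hy => by
    rw [h.supp_s hs hy, h.supp_yy hs hy, add_zero]
  have hψ0 : ContinuousOn (fun s => ψ s 0) (Iio A) :=
    hψc.comp (f := fun s : ℝ => (s, (0:ℝ))) (by fun_prop) fun s hs => ⟨hs, trivial⟩
  have hA4 : 0 < A / 4 := by linarith
  suffices hsuf : IntegrableOn f (Ioc 0 (A/4)) by
    have h2 : IntegrableOn f (Icc (A/4) (max T (A/4))) :=
      (hfc.mono fun s hs => lt_of_lt_of_le hA4 hs.1).integrableOn_Icc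
    refine (hsuf.union h2).mono_set ?_
    intro s hs
    rcases le_total s (A/4) with h3 | h3
    · exact Or.inl ⟨hs.1, h3⟩
    · exact Or.inr ⟨h3, hs.2.trans (le_max_left _ _)⟩
  set θ₀ : ℝ → ℝ := fun s => Real.smoothTransition (s + 2) * Real.smoothTransition (2 - 4 * s / A)
    with hθ₀
  have hθ : ContDiff ℝ 2 θ₀ :=
    ((Real.smoothTransition.contDiff (n := 2)).comp (contDiff_id.add contDiff_const)).mul
    ((Real.smoothTransition.contDiff (n := 2)).comp (by fun_prop))
  have hθ1 : ∀ s, A / 2 ≤ s → θ₀ s = 0 := by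
    intro s hs
    simp only [hθ₀]
    rw [Real.smoothTransition.zero_of_nonpos (x := 2 - 4 * s / A), mul_zero]
    have : 2 ≤ 4 * s / A := by rw [le_div_iff₀ hA]; linarith
    linarith
  have hθ2 : ∀ s ≤ -2, θ₀ s = 0 := by
    intro s hs
    simp only [hθ₀]
    rw [Real.smoothTransition.zero_of_nonpos (x := s + 2) (by linarith), zero_mul]
  have hθone : ∀ s, 0 ≤ s → s ≤ A / 4 → θ₀ s = 1 := by
    intro s hs hs'
    simp only [hθ₀]
    have : 4 * s / A ≤ 1 := by rw [div_le_iff₀ hA]; linarith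
    rw [Real.smoothTransition.one_of_one_le (x := s + 2) (by linarith),
      Real.smoothTransition.one_of_one_le (by linarith), one_mul]
  by_cases h_int : IntegrableOn (fun s => f s * (θ₀ s * ψ s 0)) (Ioc 0 (A/4))
  · have h2 : IntegrableOn (fun s => f s * (θ₀ s * ψ s 0)) (Icc 0 (A/4)) := by
      rw [integrableOn_Icc_iff_integrableOn_Ioc]; exact h_int
    have h3 := (h2.mul_continuousOn (g' := fun s => (ψ s 0)⁻¹) ((hψ0.mono fun s hs =>
      lt_of_le_of_lt hs.2 (by linarith)).inv₀ fun s hs =>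
        (h1 s hs.1 (lt_of_le_of_lt hs.2 (by linarith))).ne') isCompact_Icc).mono_set Ioc_subset_Icc_self
    refine h3.congr_fun ?_ measurableSet_Ioc
    intro s hs
    have := (h1 s hs.1.le (lt_of_le_of_lt hs.2 (by linarith))).ne'
    simp only [hθone s hs.1.le hs.2]
    field_simp
  exfalso
  -- for every smooth φ, the integral of f φ ψ vanishes
  have key : ∀ φ : ℝ → ℝ, ContDiff ℝ (⊤:ℕ∞) φ → HasCompactSupport φ → tsupport φ ⊆ Ioo 0 A →
      ∫ s, φ s • (f s * ψ s 0) = 0 := by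
    intro φ hφ hφs hφA
    obtain ⟨-, b, hb0, hbA, -, -, hφ1, hφ0, -, -, -⟩ := exists_theta hA hφ hφs hφA
    set c := max (A/2) b with hcdef
    have hcA : c < A := max_lt (by linarith) hbA
    have hφ2 : ContDiff ℝ 2 φ := contDiff_infty.1 hφ 2
    have W1 := weak_theta hw h hcA hθ (fun s hs => hθ1 s ((le_max_left _ _).trans hs)) hθ2
    have W2 := weak_theta hw h hcA hφ2 (fun s hs => hφ1 s ((le_max_right _ _).trans hs))
      (fun s hs => hφ0 s (by linarith))
    have W3 := weak_theta hw h hcA (hθ.add hφ2) (fun s hs => by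
      rw [hθ1 s ((le_max_left _ _).trans hs), hφ1 s ((le_max_right _ _).trans hs), add_zero])
      (fun s hs => by rw [hθ2 s hs, hφ0 s (by linarith), add_zero])
    -- nonintegrability
    have hφi : IntegrableOn (fun s => f s * (φ s * ψ s 0)) (Ioc 0 c) := by
      rcases (tsupport φ).eq_empty_or_nonempty with he | hne
      · have : φ = 0 := tsupport_eq_empty_iff.1 he
        simp [this]
      have hK := hφs.isCompact
      have : IntegrableOn (fun s => f s * (φ s * ψ s 0)) (tsupport φ) := by
        refine ContinuousOn.integrableOn_compact hK ?_
        exact (hfc.mono fun s hs => (hφA hs).1).mul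
          (hφ.continuous.continuousOn.mul (hψ0.mono fun s hs => (hφA hs).2))
      refine this.of_forall_sdiff_eq_zero measurableSet_Ioc ?_
      rintro s ⟨-, hs⟩
      rw [image_eq_zero_of_notMem_tsupport hs]; simp
    have hA4c : Ioc 0 (A/4) ⊆ Ioc 0 c := fun s hs =>
      ⟨hs.1, hs.2.trans (le_trans (by linarith) (le_max_left _ _))⟩
    have N1 : ¬ IntegrableOn (fun s => f s * (θ₀ s * ψ s 0)) (Ioc 0 c) := fun hcon =>
      h_int (hcon.mono_set hA4c)
    have N3 : ¬ IntegrableOn (fun s => f s * ((θ₀ s + φ s) * ψ s 0)) (Ioc 0 c) := fun hcon => by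
      refine N1 ((hcon.sub hφi).congr_fun ?_ measurableSet_Ioc)
      intro s _
      simp only [Pi.sub_apply]; ring
    have z1 : ∫ s in Ioc (0:ℝ) c, f s * (θ₀ s * ψ s 0) = 0 := integral_undef N1
    have z3 : ∫ s in Ioc (0:ℝ) c, f s * ((θ₀ s + φ s) * ψ s 0) = 0 := integral_undef N3
    change -(∫ s in Ioc (0:ℝ) c, ∫ y in Ioi (0:ℝ), (deriv (θ₀ + φ) s * ψ s y +
          (θ₀ s + φ s) * (ψs s y + ψyy s y)) * u s y) +
          (∫ s in Ioc (0:ℝ) c, f s * ((θ₀ s + φ s) * ψ s 0)) = ℓ * ((θ₀ 0 + φ 0) * ψ 0 0) at W3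
    rw [z1] at W1
    rw [z3] at W3
    have hgen : ∀ θ : ℝ → ℝ, ContDiff ℝ 2 θ →
        ContinuousOn (fun q : ℝ × ℝ => deriv θ q.1 * ψ q.1 q.2 +
          θ q.1 * (ψs q.1 q.2 + ψyy q.1 q.2)) (Iio A ×ˢ univ) := by
      intro θ hθ
      have hd : Continuous (deriv θ) := hθ.continuous_deriv (by norm_num)
      have hθc := hθ.continuous
      exact ((hd.comp continuous_fst).continuousOn.mul hψc).add
        ((hθc.comp continuous_fst).continuousOn.mul h.cont)
    have hgs : ∀ θ : ℝ → ℝ, ∀ s < A, ∀ y, R < |y| → deriv θ s * ψ s y +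
          θ s * (ψs s y + ψyy s y) = 0 := fun θ s hs y hy => by
      rw [h.supp s hs y hy, hLs s hs y hy]; ring
    have e1 : ∀ s ∈ Ioc (0:ℝ) c, (∫ y in Ioi (0:ℝ), (deriv (θ₀ + φ) s * ψ s y +
          (θ₀ s + φ s) * (ψs s y + ψyy s y)) * u s y) =
        (∫ y in Ioi (0:ℝ), (deriv θ₀ s * ψ s y + θ₀ s * (ψs s y + ψyy s y)) * u s y) +
        ∫ y in Ioi (0:ℝ), (deriv φ s * ψ s y + φ s * (ψs s y + ψyy s y)) * u s y := by
      intro s hs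
      have hsA : s < A := lt_of_le_of_lt hs.2 hcA
      have i1 := int_y (ψ := fun s y => deriv θ₀ s * ψ s y + θ₀ s * (ψs s y + ψyy s y))
        hs.1 hsA hc (hgen θ₀ hθ) (hgs θ₀)
      have i2 := int_y (ψ := fun s y => deriv φ s * ψ s y + φ s * (ψs s y + ψyy s y))
        hs.1 hsA hc (hgen φ hφ2) (hgs φ)
      rw [← integral_add i1 i2]
      congr 1; funext y
      rw [deriv_add (hθ.differentiable (by norm_num)).differentiableAt
        (hφ2.differentiable (by norm_num)).differentiableAt]
      ring
    rw [setIntegral_congr_fun measurableSet_Ioc e1] at W3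
    have k1 := int_s (ψ := fun s y => deriv θ₀ s * ψ s y + θ₀ s * (ψs s y + ψyy s y))
        hcA hloc (hgen θ₀ hθ) (hgs θ₀)
    have k2 := int_s (ψ := fun s y => deriv φ s * ψ s y + φ s * (ψs s y + ψyy s y))
        hcA hloc (hgen φ hφ2) (hgs φ)
    have hsp := integral_add k1 k2
    rw [hsp] at W3
    rw [hφ0 0 le_rfl] at W2 W3
    have e5 : ∫ s, φ s • (f s * ψ s 0) = ∫ s in Ioc (0:ℝ) c, f s * (φ s * ψ s 0) := by
      rw [← setIntegral_eq_integral_of_forall_compl_eq_zero (s := Ioc 0 c)]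
      · congr 1; funext s; simp only [smul_eq_mul]; ring
      · intro s hs
        have : φ s = 0 := by
          by_cases h0 : s ≤ 0
          · exact hφ0 s h0
          · refine hφ1 s ?_
            by_contra hcon
            exact hs ⟨not_le.1 h0, (not_le.1 hcon).le.trans (le_max_right _ _)⟩
        simp [this]
    rw [e5]
    simp only [zero_mul, mul_zero, add_zero] at W1 W2 W3
    linarith
  have hcont : ContinuousOn (fun s => f s * ψ s 0) (Ioo 0 A) :=
    (hfc.mono fun s hs => hs.1).mul (hψ0.mono fun s hs => hs.2)
  have hae := isOpen_Ioo.ae_eq_zero_of_integral_contDiff_smul_eq_zero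
    (hcont.locallyIntegrableOn measurableSet_Ioo) key
  have hae' : (fun s => f s * ψ s 0) =ᵐ[volume.restrict (Ioo 0 A)] fun _ => 0 :=
    (ae_restrict_iff' measurableSet_Ioo).2 hae
  have hzero := Measure.eqOn_open_of_ae_eq hae' isOpen_Ioo hcont continuousOn_const
  refine h_int ((integrableOn_zero (s := Ioc (0:ℝ) (A/4)) (μ := volume) (ε' := ℝ)).congr_fun ?_
    measurableSet_Ioc)
  intro s hs
  have := hzero (show s ∈ Ioo 0 A from ⟨hs.1, by linarith [hs.2]⟩)
  simp only at this
  have h2 : f s * (θ₀ s * ψ s 0) = θ₀ s * (f s * ψ s 0) := by ring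
  simp only [h2, this, mul_zero]


/-- Neumann heat kernel on the half line with pole at the boundary. -/
noncomputable def kk (x t : ℝ) : ℝ := Real.exp (-x^2 / (4*t)) / √(π * t)

lemma kk_pos (x : ℝ) {t : ℝ} (ht : 0 < t) : 0 < kk x t := by
  unfold kk; positivity

lemma kk_nonneg (x t : ℝ) : 0 ≤ kk x t := by
  unfold kk; positivity

lemma kk_of_nonpos (x : ℝ) {t : ℝ} (ht : t ≤ 0) : kk x t = 0 := by
  unfold kk
  rw [Real.sqrt_eq_zero_of_nonpos (mul_nonpos_of_nonneg_of_nonpos pi_pos.le ht), div_zero]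

lemma kk_neg (x t : ℝ) : kk (-x) t = kk x t := by
  unfold kk; rw [neg_sq]

lemma kk_zero (t : ℝ) : kk 0 t = 1 / √(π * t) := by
  unfold kk; simp

lemma kk_le_zero (x : ℝ) (t : ℝ) : kk x t ≤ kk 0 t := by
  rcases le_or_gt t 0 with ht | ht
  · rw [kk_of_nonpos x ht, kk_of_nonpos 0 ht]
  · rw [kk_zero]
    unfold kk
    gcongr
    rw [Real.exp_le_one_iff]
    apply div_nonpos_of_nonpos_of_nonneg
    · nlinarith [sq_nonneg x]
    · positivity

lemma kk_anti {x y t : ℝ} (ht : 0 < t) (h : |x| ≤ |y|) : kk y t ≤ kk x t := by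
  unfold kk
  have := sq_le_sq.2 h
  gcongr

lemma kk_le_inv {x t : ℝ} (ht : 0 < t) (hx : x ≠ 0) : kk x t ≤ 2 / |x| := by
  have hx' : 0 < |x| := abs_pos.2 hx
  set z := |x| / (2 * √t) with hz
  have hst : 0 < √t := Real.sqrt_pos.2 ht
  have hzp : 0 < z := by positivity
  have hz2 : z^2 = x^2/(4*t) := by
    rw [hz, div_pow, mul_pow, Real.sq_sqrt ht.le, sq_abs]; ring
  have h1 : z ≤ Real.exp (z^2) := by
    have := Real.add_one_le_exp (z^2)
    nlinarith [sq_nonneg (z - 1)]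
  have h2 : Real.exp (-x^2/(4*t)) ≤ 1 / z := by
    rw [neg_div, ← hz2, Real.exp_neg, inv_eq_one_div]
    gcongr
  have h3 : √t ≤ √(π * t) := Real.sqrt_le_sqrt (by nlinarith [Real.pi_gt_three])
  unfold kk
  calc Real.exp (-x^2/(4*t)) / √(π * t) ≤ (1/z) / √t := by gcongr
    _ = 2 / |x| := by rw [hz]; field_simp

lemma kk_hasDerivAt_x (x : ℝ) {t : ℝ} (ht : 0 < t) :
    HasDerivAt (fun x => kk x t) (-(x / (2*t)) * kk x t) x := by
  unfold kk
  have h1 : HasDerivAt (fun x : ℝ => -x^2 / (4*t)) (-(2 * x) / (4*t)) x := by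
    have := ((hasDerivAt_pow 2 x).neg).div_const (4*t)
    simpa using this
  refine ((h1.exp).div_const (√(π * t))).congr_deriv ?_
  have e : -(2 * x) / (4*t) = -(x / (2*t)) := by field_simp; ring
  rw [e]
  ring

lemma kk_hasDerivAt_t (x : ℝ) {t : ℝ} (ht : 0 < t) :
    HasDerivAt (fun t => kk x t) ((x^2/(4*t^2) - 1/(2*t)) * kk x t) t := by
  unfold kk
  have h1 : HasDerivAt (fun t : ℝ => -x^2 / (4*t)) (x^2/(4*t^2)) t := by
    have := ((hasDerivAt_id t).const_mul 4).fun_inv (by positivity : (4 * t : ℝ) ≠ 0) |>.const_mul (-x^2)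
    refine (this.congr_deriv ?_)
    simp only [id]
    field_simp
    try ring
  have hs : 0 < √(π * t) := by positivity
  have h2 : HasDerivAt (fun t : ℝ => √(π * t)) (π * 1 / (2 * √(π * t))) t :=
    ((hasDerivAt_id t).const_mul π).sqrt (by positivity)
  refine (h1.exp.fun_div h2 hs.ne').congr_deriv ?_
  have hsq : √(π * t)^2 = π * t := Real.sq_sqrt (by positivity)
  have e1 : π * 1 / (2 * √(π * t)) = √(π * t) / (2 * t) := by
    rw [div_eq_div_iff (by positivity) (by positivity)]
    linear_combination (-2) * hsq
  rw [e1]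
  generalize √(π * t) = r at *
  have hr : r ≠ 0 := hs.ne'
  field_simp

lemma kk_hasDerivAt_xx (x : ℝ) {t : ℝ} (ht : 0 < t) :
    HasDerivAt (fun x => -(x / (2*t)) * kk x t) ((x^2/(4*t^2) - 1/(2*t)) * kk x t) x := by
  have h1 : HasDerivAt (fun x : ℝ => -(x / (2*t))) (-(1/(2*t))) x :=
    ((hasDerivAt_id x).div_const (2*t)).neg
  refine (h1.mul (kk_hasDerivAt_x x ht)).congr_deriv ?_
  field_simp
  ring

lemma kk_contDiffOn : ContDiffOn ℝ 2 (fun q : ℝ × ℝ => kk q.1 q.2) (univ ×ˢ Ioi 0) := by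
  unfold kk
  refine ContDiffOn.div ?_ ?_ ?_
  · refine ContDiffOn.exp (ContDiffOn.div (by fun_prop) (by fun_prop) ?_)
    rintro ⟨x, t⟩ ⟨-, ht⟩
    have : (0:ℝ) < t := ht
    simp only; positivity
  · refine ContDiffOn.sqrt (by fun_prop) ?_
    rintro ⟨x, t⟩ ⟨-, ht⟩
    have : (0:ℝ) < t := ht
    simp only; positivity
  · rintro ⟨x, t⟩ ⟨-, ht⟩
    have : (0:ℝ) < t := ht
    simp only; positivity

lemma hasDerivAt_max_pow (n : ℕ) (z : ℝ) :
    HasDerivAt (fun z : ℝ => (max z 0)^(n+2)) ((n+2) * (max z 0)^(n+1)) z := by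
  have hne : ∀ y : ℝ, y ≠ 0 → HasDerivAt (fun z : ℝ => (max z 0)^(n+2)) ((n+2) * (max y 0)^(n+1)) y := by
    intro y hy
    rcases lt_or_gt_of_ne hy with h | h
    · rw [max_eq_right h.le]
      refine ((hasDerivAt_const y (0:ℝ)).congr_of_eventuallyEq ?_).congr_deriv (by simp)
      filter_upwards [Iio_mem_nhds h] with t ht
      rw [max_eq_right (le_of_lt ht)]; simp
    · rw [max_eq_left h.le]
      refine ((hasDerivAt_pow (n+2) y).congr_of_eventuallyEq ?_).congr_deriv (by simp)
      filter_upwards [Ioi_mem_nhds h] with t ht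
      rw [max_eq_left (le_of_lt ht)]
  by_cases hz : z = 0
  · subst hz
    exact hasDerivAt_of_hasDerivAt_of_ne (f := fun z : ℝ => (max z 0)^(n+2))
      (g := fun y => (n+2) * (max y 0)^(n+1)) hne (by fun_prop) (by fun_prop)
  · exact hne z hz

lemma contDiff_max3 : ContDiff ℝ 2 (fun z : ℝ => (max z 0)^3) := by
  have h2 : (2 : WithTop ℕ∞) = 1 + 1 := by norm_num
  have h1 : (1 : WithTop ℕ∞) = 0 + 1 := by norm_num
  have d1 := hasDerivAt_max_pow 1
  have d2 := hasDerivAt_max_pow 0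
  rw [h2, contDiff_succ_iff_deriv]
  refine ⟨fun z => (d1 z).differentiableAt, by simp, ?_⟩
  have e1 : deriv (fun z : ℝ => (max z 0)^3) = fun z => (((1:ℕ):ℝ)+2) * (max z 0)^2 :=
    funext fun z => (d1 z).deriv
  rw [e1, h1, contDiff_succ_iff_deriv]
  refine ⟨fun z => ((d2 z).const_mul _).differentiableAt, by simp, ?_⟩
  have e2 : deriv (fun z : ℝ => (((1:ℕ):ℝ)+2) * (max z 0)^2) =
      fun z => (((1:ℕ):ℝ)+2) * ((((0:ℕ):ℝ)+2) * (max z 0)^1) :=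
    funext fun z => ((d2 z).const_mul _).deriv
  rw [e2]
  exact contDiff_zero.2 (by fun_prop)

/-- convex truncation -/
noncomputable def JJ (ε z : ℝ) : ℝ := (max (z - ε) 0)^3 / z^2
noncomputable def JJ1 (ε z : ℝ) : ℝ := (max (z - ε) 0)^2 * (z + 2*ε) / z^3
noncomputable def JJ2 (ε z : ℝ) : ℝ := 6 * ε^2 * (max (z - ε) 0) / z^4

lemma JJ_deriv (ε : ℝ) {z : ℝ} (hz : 0 < z) : HasDerivAt (JJ ε) (JJ1 ε z) z := by
  have h1 : HasDerivAt (fun z : ℝ => (max (z - ε) 0)^3) (3 * (max (z-ε) 0)^2) z := by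
    have := (hasDerivAt_max_pow 1 (z - ε)).comp_sub_const z ε
    refine this.congr_deriv ?_
    norm_num
  refine (h1.fun_div (hasDerivAt_pow 2 z) (by positivity)).congr_deriv ?_
  unfold JJ1
  rcases le_total z ε with h | h
  · rw [max_eq_right (by linarith)]; simp
  · rw [max_eq_left (by linarith)]
    field_simp
    push_cast
    ring

lemma JJ1_deriv (ε : ℝ) {z : ℝ} (hz : 0 < z) : HasDerivAt (JJ1 ε) (JJ2 ε z) z := by
  have h1 : HasDerivAt (fun z : ℝ => (max (z - ε) 0)^2) (2 * (max (z-ε) 0)) z := by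
    have := (hasDerivAt_max_pow 0 (z - ε)).comp_sub_const z ε
    refine this.congr_deriv ?_
    norm_num
  have h2 : HasDerivAt (fun z : ℝ => (max (z - ε) 0)^2 * (z + 2*ε)) _ z :=
    h1.mul ((hasDerivAt_id z).add_const (2*ε))
  refine (h2.fun_div (hasDerivAt_pow 3 z) (by positivity)).congr_deriv ?_
  unfold JJ2
  rcases le_total z ε with h | h
  · rw [max_eq_right (by linarith)]; simp
  · rw [max_eq_left (by linarith)]
    field_simp
    push_cast
    ring

lemma JJ_nonneg (ε z : ℝ) : 0 ≤ JJ ε z := by unfold JJ; positivity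

lemma JJ_le {ε z : ℝ} (hε : 0 ≤ ε) (hz : 0 < z) : JJ ε z ≤ z := by
  unfold JJ
  rw [div_le_iff₀ (by positivity)]
  have h1 : max (z - ε) 0 ≤ z := max_le (by linarith) hz.le
  calc (max (z-ε) 0)^3 ≤ z^3 := by gcongr
    _ = z * z^2 := by ring

lemma JJ_zero {ε z : ℝ} (h : z ≤ ε) : JJ ε z = 0 := by
  unfold JJ; rw [max_eq_right (by linarith)]; simp

lemma JJ_pos {ε z : ℝ} (hε : 0 < ε) (h : ε < z) : 0 < JJ ε z := by
  unfold JJ; rw [max_eq_left (by linarith)]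
  have : 0 < z - ε := by linarith
  have : 0 < z := by linarith
  positivity

lemma JJ2_nonneg (ε z : ℝ) : 0 ≤ JJ2 ε z := by unfold JJ2; positivity

lemma JJ2_le {ε z : ℝ} (hε : 0 ≤ ε) (hz : 0 < z) : JJ2 ε z ≤ 6 / z := by
  unfold JJ2
  rcases le_total z ε with h | h
  · rw [max_eq_right (by linarith)]; simp; positivity
  · rw [max_eq_left (by linarith), div_le_div_iff₀ (by positivity) hz]
    have h1 : ε^2 ≤ z^2 := by gcongr
    have h2 : ε^2 * (z - ε) ≤ z^2 * z := by
      apply mul_le_mul h1 (by linarith) (by linarith) (by positivity)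
    nlinarith

lemma JJ_tendsto {z : ℝ} (hz : 0 < z) {ε : ℕ → ℝ} {w : ℕ → ℝ} (hε : Tendsto ε atTop (𝓝 0))
    (hw : Tendsto w atTop (𝓝 z)) :
    Tendsto (fun n => JJ (ε n) (w n)) atTop (𝓝 z) := by
  have : Tendsto (fun n => (max (w n - ε n) 0)^3 / (w n)^2) atTop (𝓝 ((max (z - 0) 0)^3 / z^2)) :=
    (((hw.sub hε).max tendsto_const_nhds).pow 3).div (hw.pow 2) (by positivity)
  rw [sub_zero, max_eq_left hz.le] at this
  have e : z^3/z^2 = z := by field_simp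
  rw [e] at this
  exact this

lemma JJ2_tendsto (z : ℝ) {ε : ℕ → ℝ} (hε : Tendsto ε atTop (𝓝 0)) :
    Tendsto (fun n => JJ2 (ε n) z) atTop (𝓝 0) := by
  unfold JJ2
  have : Tendsto (fun n => 6 * (ε n)^2 * (max (z - ε n) 0) / z^4) atTop
      (𝓝 (6 * 0^2 * (max (z - 0) 0) / z^4)) :=
    (((hε.pow 2).const_mul 6).mul ((tendsto_const_nhds.sub hε).max tendsto_const_nhds)).div_const _
  simpa using this


/-- backward Neumann kernel -/
noncomputable def FF (x A s y : ℝ) : ℝ := (kk (y-x) (A-s) + kk (y+x) (A-s))/2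
noncomputable def FFy (x A s y : ℝ) : ℝ :=
  (-((y-x)/(2*(A-s))) * kk (y-x) (A-s) + -((y+x)/(2*(A-s))) * kk (y+x) (A-s))/2
noncomputable def FFyy (x A s y : ℝ) : ℝ :=
  (((y-x)^2/(4*(A-s)^2) - 1/(2*(A-s))) * kk (y-x) (A-s)
    + ((y+x)^2/(4*(A-s)^2) - 1/(2*(A-s))) * kk (y+x) (A-s))/2

lemma FF_pos (x y : ℝ) {A s : ℝ} (h : s < A) : 0 < FF x A s y := by
  have h1 := kk_pos (y-x) (sub_pos.2 h)
  have h2 := kk_pos (y+x) (sub_pos.2 h)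
  unfold FF; positivity

lemma FF_zero (x A s : ℝ) : FF x A s 0 = kk x (A-s) := by
  unfold FF; rw [zero_sub, kk_neg, zero_add]; ring

lemma FF_zero_x (A s y : ℝ) : FF 0 A s y = kk y (A-s) := by
  unfold FF; rw [sub_zero, add_zero]; ring

lemma FF_ds (x y : ℝ) {A s : ℝ} (h : s < A) :
    HasDerivAt (fun s => FF x A s y) (- FFyy x A s y) s := by
  have hA : HasDerivAt (fun s : ℝ => A - s) (-1) s := by
    simpa using (hasDerivAt_id s).const_sub A
  have h1 := (kk_hasDerivAt_t (y-x) (sub_pos.2 h)).comp s hA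
  have h2 := (kk_hasDerivAt_t (y+x) (sub_pos.2 h)).comp s hA
  refine ((h1.add h2).div_const 2).congr_deriv ?_
  unfold FFyy; ring

lemma FF_dy (x y : ℝ) {A s : ℝ} (h : s < A) :
    HasDerivAt (FF x A s) (FFy x A s y) y := by
  have h1 := (kk_hasDerivAt_x (y-x) (sub_pos.2 h)).comp_sub_const y x
  have h2 := (kk_hasDerivAt_x (y+x) (sub_pos.2 h)).comp_add_const y x
  exact (h1.add h2).div_const 2

lemma FF_dyy (x y : ℝ) {A s : ℝ} (h : s < A) :
    HasDerivAt (FFy x A s) (FFyy x A s y) y := by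
  have h1 := (kk_hasDerivAt_xx (y-x) (sub_pos.2 h)).comp_sub_const y x
  have h2 := (kk_hasDerivAt_xx (y+x) (sub_pos.2 h)).comp_add_const y x
  exact (h1.add h2).div_const 2

lemma FF_contDiffOn (x A : ℝ) :
    ContDiffOn ℝ 2 (fun q : ℝ × ℝ => FF x A q.1 q.2) (Iio A ×ˢ univ) := by
  unfold FF
  refine ContDiffOn.div_const (ContDiffOn.add ?_ ?_) 2
  · exact kk_contDiffOn.comp (g := fun q : ℝ × ℝ => kk q.1 q.2)
      (f := fun q : ℝ × ℝ => (q.2 - x, A - q.1)) (by fun_prop)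
      fun q hq => ⟨trivial, (sub_pos.2 hq.1 : (0:ℝ) < A - q.1)⟩
  · exact kk_contDiffOn.comp (g := fun q : ℝ × ℝ => kk q.1 q.2)
      (f := fun q : ℝ × ℝ => (q.2 + x, A - q.1)) (by fun_prop)
      fun q hq => ⟨trivial, (sub_pos.2 hq.1 : (0:ℝ) < A - q.1)⟩

lemma FFy_contOn (x A : ℝ) :
    ContinuousOn (fun q : ℝ × ℝ => FFy x A q.1 q.2) (Iio A ×ˢ univ) := by
  have h0 : ∀ q ∈ Iio A ×ˢ (univ : Set ℝ), (2 * (A - q.1)) ≠ 0 := by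
    rintro q ⟨hq, -⟩
    have : 0 < A - q.1 := sub_pos.2 hq
    positivity
  have k1 : ContinuousOn (fun q : ℝ × ℝ => kk (q.2 - x) (A - q.1)) (Iio A ×ˢ univ) :=
    kk_contDiffOn.continuousOn.comp (g := fun q : ℝ × ℝ => kk q.1 q.2)
      (f := fun q : ℝ × ℝ => (q.2 - x, A - q.1)) (by fun_prop)
      fun q hq => ⟨trivial, (sub_pos.2 hq.1 : (0:ℝ) < A - q.1)⟩
  have k2 : ContinuousOn (fun q : ℝ × ℝ => kk (q.2 + x) (A - q.1)) (Iio A ×ˢ univ) :=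
    kk_contDiffOn.continuousOn.comp (g := fun q : ℝ × ℝ => kk q.1 q.2)
      (f := fun q : ℝ × ℝ => (q.2 + x, A - q.1)) (by fun_prop)
      fun q hq => ⟨trivial, (sub_pos.2 hq.1 : (0:ℝ) < A - q.1)⟩
  unfold FFy
  refine ContinuousOn.div_const (ContinuousOn.add (ContinuousOn.mul ?_ k1)
    (ContinuousOn.mul ?_ k2)) 2
  · exact (ContinuousOn.div (by fun_prop) (by fun_prop) h0).neg
  · exact (ContinuousOn.div (by fun_prop) (by fun_prop) h0).neg

lemma JJ_adm {ε x A : ℝ} (hε : 0 < ε) (hx : 0 ≤ x) :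
    Adm A (x + 2/ε) (fun s y => JJ ε (FF x A s y))
      (fun s y => JJ1 ε (FF x A s y) * (- FFyy x A s y))
      (fun s y => JJ1 ε (FF x A s y) * FFy x A s y)
      (fun s y => JJ2 ε (FF x A s y) * FFy x A s y * FFy x A s y
        + JJ1 ε (FF x A s y) * FFyy x A s y) where
  smooth := by
    unfold JJ
    refine ContDiffOn.div ?_ ((FF_contDiffOn x A).pow 2) ?_
    · exact contDiff_max3.comp_contDiffOn ((FF_contDiffOn x A).sub contDiffOn_const)
    · rintro q ⟨hq, -⟩
      have := FF_pos x q.2 hq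
      positivity
  ds s hs y := HasDerivAt.comp (h₂ := JJ ε) s (JJ_deriv ε (FF_pos x y hs)) (FF_ds x y hs)
  dy s hs y := (JJ_deriv ε (FF_pos x y hs)).comp y (FF_dy x y hs)
  dyy s hs y := ((JJ1_deriv ε (FF_pos x y hs)).comp y (FF_dy x y hs)).mul (FF_dyy x y hs)
  cont := by
    have e : (fun q : ℝ × ℝ => JJ1 ε (FF x A q.1 q.2) * (- FFyy x A q.1 q.2) +
      (JJ2 ε (FF x A q.1 q.2) * FFy x A q.1 q.2 * FFy x A q.1 q.2
        + JJ1 ε (FF x A q.1 q.2) * FFyy x A q.1 q.2)) =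
        fun q => JJ2 ε (FF x A q.1 q.2) * FFy x A q.1 q.2 * FFy x A q.1 q.2 := by
      funext q; ring
    rw [e]
    have hF := (FF_contDiffOn x A).continuousOn
    refine ContinuousOn.mul (ContinuousOn.mul ?_ (FFy_contOn x A)) (FFy_contOn x A)
    unfold JJ2
    refine ContinuousOn.div ?_ (hF.pow 4) ?_
    · exact continuousOn_const.mul (ContinuousOn.sup (hF.sub continuousOn_const) continuousOn_const)
    · rintro q ⟨hq, -⟩
      have := FF_pos x q.2 hq
      positivity
  supp s hs y hy := by
    apply JJ_zero
    have hA : 0 < A - s := sub_pos.2 hs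
    have h2 : 0 < 2/ε := by positivity
    have key : ∀ z : ℝ, 2/ε ≤ |z| → kk z (A - s) ≤ ε := by
      intro z hz
      have hz0 : 0 < |z| := by linarith
      refine (kk_le_inv hA (abs_pos.1 hz0)).trans ?_
      rw [div_le_iff₀ hz0]
      rw [div_le_iff₀ hε] at hz
      linarith
    have e1 := key (y - x) (by
      have := abs_sub_abs_le_abs_sub y x
      rw [abs_of_nonneg hx] at this
      linarith)
    have e2 := key (y + x) (by
      have := abs_sub_abs_le_abs_sub y (-x)
      rw [abs_neg, abs_of_nonneg hx, sub_neg_eq_add] at this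
      linarith)
    unfold FF; linarith
  even s hs := by
    unfold FFy
    rw [zero_sub, kk_neg, zero_add]; ring

/-- solution package -/
structure Sol (ℓ : ℝ) (u : ℝ → ℝ → ℝ) (f : ℝ → ℝ) : Prop where
  weak : WeakId ℓ u f
  loc : LocallyIntegrableOn (fun q : ℝ × ℝ => u q.1 q.2) (Ici 0 ×ˢ Ici 0) volume
  cont : ContinuousOn (fun q : ℝ × ℝ => u q.1 q.2) (Ioi 0 ×ˢ Ici 0)
  fcont : ContinuousOn f (Ioi 0)
  nn : ∀ t x : ℝ, 0 < t → 0 ≤ x → 0 ≤ u t x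
  fnn : ∀ t : ℝ, 0 < t → 0 ≤ f t

lemma Sol.fint {ℓ : ℝ} {u : ℝ → ℝ → ℝ} {f : ℝ → ℝ} (h : Sol ℓ u f) (T : ℝ) :
    IntegrableOn f (Ioc 0 T) := by
  have hk := kk_pos 0 one_pos
  refine flux_int h.weak h.loc h.cont h.fcont (JJ_adm (ε := kk 0 1 / 2) (x := 0) (A := 1)
    (by positivity) le_rfl) one_pos ?_ T
  intro s hs0 hs1
  refine JJ_pos (by positivity) ?_
  rw [FF_zero]
  have : kk 0 1 ≤ kk 0 (1 - s) := by
    rw [kk_zero, kk_zero]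
    have h1 : 0 < 1 - s := by linarith
    have h2 : 1 - s ≤ 1 := by linarith
    gcongr
  linarith

/-- truncated Neumann kernel identity -/
lemma Sol.trunc {ℓ : ℝ} {u : ℝ → ℝ → ℝ} {f : ℝ → ℝ} (h : Sol ℓ u f) {ε x A T : ℝ} (hε : 0 < ε)
    (hx : 0 ≤ x) (hT : 0 < T) (hTA : T < A) :
    (∫ y in Ioi (0:ℝ), JJ ε (FF x A T y) * u T y) + (∫ s in Ioc 0 T, f s * JJ ε (kk x (A - s)))
      = ℓ * JJ ε (kk x A)
        + ∫ s in Ioc 0 T, ∫ y in Ioi (0:ℝ), JJ2 ε (FF x A s y) * (FFy x A s y)^2 * u s y := by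
  have := weak_time h.weak h.loc h.cont h.fcont h.fint (JJ_adm (A := A) hε hx) hT hTA
  simp only [FF_zero, sub_zero] at this
  rw [this]
  congr 2
  funext s
  congr 1
  funext y
  ring


lemma Adm.ints {A R T : ℝ} {u ψ ψs ψy ψyy : ℝ → ℝ → ℝ} (h : Adm A R ψ ψs ψy ψyy) (hT : T < A)
    (hloc : LocallyIntegrableOn (fun q : ℝ × ℝ => u q.1 q.2) (Ici 0 ×ˢ Ici 0) volume) :
    IntegrableOn (fun s => ∫ y in Ioi (0:ℝ), (ψs s y + ψyy s y) * u s y) (Ioc 0 T) :=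
  int_s (ψ := fun s y => ψs s y + ψyy s y) (R := R) hT hloc h.cont (fun r hr y hy => by
          rw [h.supp_s hr hy, h.supp_yy hr hy, add_zero])

lemma Adm.inty {A R s : ℝ} {u ψ ψs ψy ψyy : ℝ → ℝ → ℝ} (h : Adm A R ψ ψs ψy ψyy) (hs0 : 0 < s)
    (hs : s < A) (hc : ContinuousOn (fun q : ℝ × ℝ => u q.1 q.2) (Ioi 0 ×ˢ Ici 0)) :
    IntegrableOn (fun y => (ψs s y + ψyy s y) * u s y) (Ioi 0) :=
  int_y (ψ := fun s y => ψs s y + ψyy s y) (R := R) hs0 hs hc h.cont (fun r hr y hy => by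
          rw [h.supp_s hr hy, h.supp_yy hr hy, add_zero])

lemma kk_cont_t (x : ℝ) : ContinuousOn (fun t => kk x t) (Ioi 0) :=
  fun _ ht => (kk_hasDerivAt_t x ht).continuousAt.continuousWithinAt

lemma kk_cont_x (t : ℝ) : Continuous (fun x => kk x t) := by
  unfold kk; fun_prop

lemma kk_meas : Measurable (fun q : ℝ × ℝ => kk q.1 q.2) := by
  unfold kk; fun_prop

lemma kk_anti_t {s t : ℝ} (hs : 0 < s) (hst : s ≤ t) : kk 0 t ≤ kk 0 s := by
  rw [kk_zero, kk_zero]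
  gcongr

lemma kk_zero_rpow {t : ℝ} (ht : 0 < t) : kk 0 t = π^(-(1/2:ℝ)) * t^(-(1/2:ℝ)) := by
  rw [kk_zero, Real.sqrt_eq_rpow, ← Real.mul_rpow pi_pos.le ht.le, Real.rpow_neg (by positivity)]
  simp

lemma kk_zero_int (T : ℝ) : IntegrableOn (fun t => kk 0 t) (Ioc 0 T) := by
  rcases le_or_gt T 0 with h | h
  · rw [Ioc_eq_empty (by simpa using h)]; exact integrableOn_empty
  have h1 : IntegrableOn (fun t : ℝ => π^(-(1/2:ℝ)) * t^(-(1/2:ℝ))) (Ioc 0 T) := by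
    have := (intervalIntegral.intervalIntegrable_rpow' (a := 0) (b := T)
      (by norm_num : (-1:ℝ) < -(1/2))).const_mul (π^(-(1/2:ℝ)))
    rwa [intervalIntegrable_iff_integrableOn_Ioc_of_le h.le] at this
  exact h1.congr_fun (fun t ht => (kk_zero_rpow ht.1).symm) measurableSet_Ioc

lemma kk_zero_int_refl (T : ℝ) (hT : 0 ≤ T) : IntegrableOn (fun s => kk 0 (T - s)) (Ioc 0 T) := by
  have h := kk_zero_int T
  rw [← intervalIntegrable_iff_integrableOn_Ioc_of_le hT] at h ⊢
  have := (h.comp_sub_left T).symm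
  simpa using this

lemma fk_int {f : ℝ → ℝ} (hfi : ∀ T, IntegrableOn f (Ioc 0 T)) (hfc : ContinuousOn f (Ioi 0))
    (x : ℝ) {T : ℝ} (hT : 0 < T) : IntegrableOn (fun s => f s * kk x (T - s)) (Ioc 0 T) := by
  suffices h0 : IntegrableOn (fun s => f s * kk 0 (T - s)) (Ioc 0 T) by
    refine Integrable.mono h0 ?_ ?_
    · refine (hfi T).aestronglyMeasurable.mul ?_
      have : Measurable (fun s : ℝ => kk x (T - s)) :=
        kk_meas.comp (measurable_const.prodMk (measurable_const.sub measurable_id))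
      exact this.aestronglyMeasurable
    · refine Eventually.of_forall fun s => ?_
      rw [norm_mul, norm_mul, Real.norm_of_nonneg (kk_nonneg _ _), Real.norm_of_nonneg (kk_nonneg _ _)]
      exact mul_le_mul_of_nonneg_left (kk_le_zero _ _) (norm_nonneg _)
  have h1 : IntegrableOn (fun s => f s * kk 0 (T - s)) (Icc 0 (T/2)) := by
    have hf : IntegrableOn f (Icc 0 (T/2)) := by
      rw [integrableOn_Icc_iff_integrableOn_Ioc]; exact hfi _
    refine hf.mul_continuousOn ?_ isCompact_Icc
    exact (kk_cont_t 0).comp (f := fun s => T - s) (by fun_prop) fun s hs => by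
      have := hs.2
      simp only [mem_Ioi]; linarith
  have h2 : IntegrableOn (fun s => f s * kk 0 (T - s)) (Icc (T/2) T) := by
    have hk : IntegrableOn (fun s => kk 0 (T - s)) (Icc (T/2) T) := by
      rw [integrableOn_Icc_iff_integrableOn_Ioc]
      exact (kk_zero_int_refl T hT.le).mono_set (Ioc_subset_Ioc_left (by linarith))
    exact hk.continuousOn_mul (hfc.mono fun s hs => by
      have := hs.1
      simp only [mem_Ioi]; linarith) isCompact_Icc
  refine (h1.union h2).mono_set ?_
  intro s hs
  rcases le_total s (T/2) with h | h
  · exact Or.inl ⟨hs.1.le, h⟩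
  · exact Or.inr ⟨h, hs.2⟩

lemma kk_x_int {t : ℝ} (ht : 0 < t) : IntegrableOn (fun y => kk y t) (Ioi 0) := by
  have h : Integrable (fun y : ℝ => Real.exp (-(1/(4*t)) * y^2)) :=
    integrable_exp_neg_mul_sq (by positivity)
  have := (h.div_const (√(π * t))).integrableOn (s := Ioi (0:ℝ))
  refine this.congr_fun (fun y _ => ?_) measurableSet_Ioi
  unfold kk
  simp only
  congr 2
  ring

lemma kk_x_integral {t : ℝ} (ht : 0 < t) : ∫ y in Ioi (0:ℝ), kk y t = 1 := by
  have h := integral_gaussian_Ioi (1/(4*t))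
  have e : ∀ y : ℝ, kk y t = Real.exp (-(1/(4*t)) * y^2) / √(π * t) := by
    intro y; unfold kk; congr 2; ring
  simp_rw [e]
  rw [integral_div, h]
  have : π / (1/(4*t)) = 2^2 * (π * t) := by field_simp; ring
  rw [this, Real.sqrt_mul (by positivity), Real.sqrt_sq (by norm_num)]
  have : 0 < √(π * t) := by positivity
  field_simp

lemma kk_one_le {t : ℝ} (ht : 0 < t) : kk 1 t ≤ 4 * √t := by
  have h1 : Real.exp (-1^2/(4*t)) ≤ 4 * t := by
    have := Real.add_one_le_exp (1/(4*t))
    have h2 : 0 < 1/(4*t) := by positivity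
    have e : -(1:ℝ)^2/(4*t) = -(1/(4*t)) := by ring
    rw [e, Real.exp_neg, inv_le_comm₀ (by positivity) (by positivity), ← one_div]
    linarith
  have h3 : √t ≤ √(π * t) := Real.sqrt_le_sqrt (by nlinarith [Real.pi_gt_three])
  have h4 : 0 < √t := Real.sqrt_pos.2 ht
  unfold kk
  calc Real.exp (-1^2/(4*t)) / √(π*t) ≤ 4 * t / √t := by gcongr
    _ = 4 * √t := by
      rw [div_eq_iff h4.ne', mul_assoc, Real.mul_self_sqrt ht.le]

lemma delta_tendsto : Tendsto (fun n : ℕ => 1 / ((n:ℝ) + 1)) atTop (𝓝 0) :=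
  tendsto_one_div_add_atTop_nhds_zero_nat

lemma Sol.cont_slice {ℓ : ℝ} {u : ℝ → ℝ → ℝ} {f : ℝ → ℝ} (h : Sol ℓ u f) {s : ℝ} (hs : 0 < s) :
    ContinuousOn (u s) (Ici 0) :=
  h.cont.comp (f := fun y : ℝ => (s, y)) (by fun_prop) fun y hy => ⟨hs, hy⟩

lemma Sol.gauss {ℓ : ℝ} {u : ℝ → ℝ → ℝ} {f : ℝ → ℝ} (h : Sol ℓ u f) {T : ℝ} (hT : 0 < T) :
    ∃ C : ℝ, 0 ≤ C ∧ ∀ s, 0 < s → s < T → IntegrableOn (fun y => kk y (T-s) * u s y) (Ioi 0) ∧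
      ∫ y in Ioi (0:ℝ), kk y (T-s) * u s y ≤ C := by
  obtain ⟨M, hM⟩ := isCompact_Icc.exists_bound_of_continuousOn
    ((h.cont_slice hT).mono (Icc_subset_Ici_self : Icc (0:ℝ) 1 ⊆ Ici 0))
  have hM0 : 0 ≤ M := (norm_nonneg _).trans (hM 0 (by simp))
  set C := M + ∫ r in Ioc 0 T, f r * kk 0 (T - r) with hC
  have hI0 : 0 ≤ ∫ r in Ioc 0 T, f r * kk 0 (T - r) :=
    setIntegral_nonneg measurableSet_Ioc fun r hr => mul_nonneg (h.fnn r hr.1) (kk_nonneg _ _)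
  refine ⟨C, by positivity, ?_⟩
  intro s hs0 hsT
  set δ : ℕ → ℝ := fun n => 1 / ((n:ℝ)+1) with hδ
  have hδ0 : ∀ n, 0 < δ n := fun n => by simp only [hδ]; positivity
  have hδt : Tendsto δ atTop (𝓝 0) := delta_tendsto
  set ε : ℕ → ℝ := fun n => kk 1 (δ n) with hε
  have hε0 : ∀ n, 0 < ε n := fun n => kk_pos _ (hδ0 n)
  have hεt : Tendsto ε atTop (𝓝 0) := by
    have h4 : Tendsto (fun n => 4 * √(δ n)) atTop (𝓝 (4 * √0)) :=
      ((Real.continuous_sqrt.tendsto 0).comp hδt).const_mul 4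
    rw [Real.sqrt_zero, mul_zero] at h4
    exact squeeze_zero (fun n => (hε0 n).le) (fun n => kk_one_le (hδ0 n)) h4
  set G : ℕ → ℝ → ℝ := fun n y => JJ (ε n) (FF 0 (T + δ n) s y) * u s y with hG
  have adm := fun n => JJ_adm (ε := ε n) (x := 0) (A := T + δ n) (hε0 n) le_rfl
  have hsA : ∀ n, s < T + δ n := fun n => by have := hδ0 n; linarith
  have hTA : ∀ n, T < T + δ n := fun n => by have := hδ0 n; linarith
  have hGi : ∀ n, IntegrableOn (G n) (Ioi 0) := fun n =>
    int_y hs0 (hsA n) h.cont (adm n).smooth.continuousOn (adm n).supp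
  have hGn : ∀ n, ∀ y ∈ Ioi (0:ℝ), 0 ≤ G n y := fun n y hy =>
    mul_nonneg (JJ_nonneg _ _) (h.nn s y hs0 (le_of_lt hy))
  have hGle : ∀ n, ∫ y in Ioi (0:ℝ), G n y ≤ C := by
    intro n
    have e1 := h.trunc (hε0 n) le_rfl hs0 (hsA n)
    have e2 := h.trunc (hε0 n) le_rfl hT (hTA n)
    have m1 : ∫ r in Ioc 0 s, (∫ y in Ioi (0:ℝ), JJ2 (ε n) (FF 0 (T + δ n) r y) * (FFy 0 (T + δ n) r y)^2 * u r y)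
        ≤ ∫ r in Ioc 0 T, (∫ y in Ioi (0:ℝ), JJ2 (ε n) (FF 0 (T + δ n) r y) * (FFy 0 (T + δ n) r y)^2 * u r y) := by
      refine setIntegral_mono_set ?_ ?_ (Ioc_subset_Ioc_right hsT.le).eventuallyLE
      · have := (adm n).ints (hTA n) h.loc
        refine this.congr_fun (fun r _ => ?_) measurableSet_Ioc
        simp only
        congr 1
        funext y
        ring
      · filter_upwards [ae_restrict_mem measurableSet_Ioc] with r hr
        refine setIntegral_nonneg measurableSet_Ioi fun y hy => ?_
        exact mul_nonneg (mul_nonneg (JJ2_nonneg _ _) (sq_nonneg _)) (h.nn r y hr.1 (le_of_lt hy))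
    have m2 : 0 ≤ ∫ r in Ioc 0 s, f r * JJ (ε n) (kk 0 (T + δ n - r)) :=
      setIntegral_nonneg measurableSet_Ioc fun r hr => mul_nonneg (h.fnn r hr.1) (JJ_nonneg _ _)
    have m3 : ∫ r in Ioc 0 T, f r * JJ (ε n) (kk 0 (T + δ n - r)) ≤
        ∫ r in Ioc 0 T, f r * kk 0 (T - r) := by
      rw [integral_Ioc_eq_integral_Ioo, integral_Ioc_eq_integral_Ioo]
      refine integral_mono_of_nonneg ?_ ((fk_int h.fint h.fcont 0 hT).mono_set Ioo_subset_Ioc_self) ?_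
      · filter_upwards [ae_restrict_mem measurableSet_Ioo] with r hr
        exact mul_nonneg (h.fnn r hr.1) (JJ_nonneg _ _)
      · filter_upwards [ae_restrict_mem measurableSet_Ioo] with r hr
        have h1 : 0 < T - r := sub_pos.2 hr.2
        have h2 : T - r ≤ T + δ n - r := by have := hδ0 n; linarith
        exact mul_le_mul_of_nonneg_left ((JJ_le (hε0 n).le (kk_pos _ (h1.trans_le h2))).trans
          (kk_anti_t h1 h2)) (h.fnn r hr.1)
    have m4 : ∫ y in Ioi (0:ℝ), JJ (ε n) (FF 0 (T + δ n) T y) * u T y ≤ M := by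
      have : ∫ y in Ioi (0:ℝ), JJ (ε n) (FF 0 (T + δ n) T y) * u T y ≤
          ∫ y in Ioi (0:ℝ), M * kk y (δ n) := by
        refine integral_mono_of_nonneg ?_ ((kk_x_int (hδ0 n)).const_mul M) ?_
        · filter_upwards [ae_restrict_mem measurableSet_Ioi] with y hy
          exact mul_nonneg (JJ_nonneg _ _) (h.nn T y hT (le_of_lt hy))
        · filter_upwards [ae_restrict_mem measurableSet_Ioi] with y hy
          have hy0 : 0 < y := hy
          rw [FF_zero_x, add_sub_cancel_left]
          rcases le_total y 1 with h1 | h1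
          · have := hM y ⟨hy0.le, h1⟩
            rw [Real.norm_of_nonneg (h.nn T y hT hy0.le)] at this
            rw [mul_comm]
            exact mul_le_mul this (JJ_le (hε0 n).le (kk_pos _ (hδ0 n))) (JJ_nonneg _ _) hM0
          · rw [JJ_zero, zero_mul]
            · exact mul_nonneg hM0 (kk_nonneg _ _)
            · exact kk_anti (hδ0 n) (by rw [abs_of_pos hy0, abs_one]; exact h1)
      rwa [integral_const_mul, kk_x_integral (hδ0 n), mul_one] at this
    simp only [hG]
    linarith
  have hlim : ∀ y, Tendsto (fun n => G n y) atTop (𝓝 (kk y (T - s) * u s y)) := by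
    intro y
    refine (JJ_tendsto (kk_pos y (sub_pos.2 hsT)) hεt ?_).mul_const _
    simp_rw [FF_zero_x]
    have h1 : Tendsto (fun n => T + δ n - s) atTop (𝓝 (T - s)) := by
      simpa using (hδt.const_add T).sub_const s
    exact (kk_hasDerivAt_t y (sub_pos.2 hsT)).continuousAt.tendsto.comp h1
  have hnn : 0 ≤ᵐ[volume.restrict (Ioi 0)] fun y => kk y (T - s) * u s y := by
    filter_upwards [ae_restrict_mem measurableSet_Ioi] with y hy
    exact mul_nonneg (kk_nonneg _ _) (h.nn s y hs0 (le_of_lt hy))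
  have hmeas : AEStronglyMeasurable (fun y => kk y (T - s) * u s y) (volume.restrict (Ioi 0)) :=
    aestronglyMeasurable_of_tendsto_ae atTop (fun n => (hGi n).aestronglyMeasurable)
      (Eventually.of_forall hlim)
  have hfat : ∫⁻ y in Ioi (0:ℝ), ENNReal.ofReal (kk y (T - s) * u s y) ≤ ENNReal.ofReal C := by
    calc ∫⁻ y in Ioi (0:ℝ), ENNReal.ofReal (kk y (T - s) * u s y)
        = ∫⁻ y in Ioi (0:ℝ), liminf (fun n => ENNReal.ofReal (G n y)) atTop := by
          refine lintegral_congr fun y => ?_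
          exact ((ENNReal.tendsto_ofReal (hlim y)).liminf_eq).symm
      _ ≤ liminf (fun n => ∫⁻ y in Ioi (0:ℝ), ENNReal.ofReal (G n y)) atTop :=
          lintegral_liminf_le' fun n => (hGi n).aestronglyMeasurable.aemeasurable.ennreal_ofReal
      _ ≤ ENNReal.ofReal C := by
          refine liminf_le_of_le (by isBoundedDefault) fun b hb => ?_
          obtain ⟨n, hn⟩ := hb.exists
          refine hn.trans ?_
          rw [← ofReal_integral_eq_lintegral_ofReal (hGi n)]
          · exact ENNReal.ofReal_le_ofReal (hGle n)
          · filter_upwards [ae_restrict_mem measurableSet_Ioi] with y hy using hGn n y hy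
  have h_int : IntegrableOn (fun y => kk y (T - s) * u s y) (Ioi 0) := by
    refine ⟨hmeas, ?_⟩
    rw [hasFiniteIntegral_iff_ofReal hnn]
    exact hfat.trans_lt ENNReal.ofReal_lt_top
  refine ⟨h_int, ?_⟩
  rw [← ofReal_integral_eq_lintegral_ofReal h_int hnn] at hfat
  exact (ENNReal.ofReal_le_ofReal_iff (by positivity)).1 hfat


lemma FF_dom {x A T : ℝ} (hx : 0 ≤ x) (hT : 0 < T) (hTA : T < A) :
    ∃ C : ℝ, 0 ≤ C ∧ ∀ s, 0 < s → s ≤ T → ∀ y, 0 ≤ y →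
      FF x A s y ≤ C * kk y (4*A - s) ∧
      6 / FF x A s y * (FFy x A s y)^2 ≤ C * kk y (4*A - s) := by
  have hA : 0 < A := hT.trans hTA
  have hδ : 0 < A - T := sub_pos.2 hTA
  set D := (1 + 48*A + 2*x^2) * Real.exp (x^2/(4*A)) with hD
  set K := D / √(π * (A-T)) * √(π * (4*A)) with hK
  have hD0 : 0 ≤ D := by positivity
  have hK0 : 0 ≤ K := by positivity
  refine ⟨(1 + 6/(4*(A-T)^2)) * K, by positivity, ?_⟩
  intro s hs0 hsT y hy
  have hτ : 0 < A - s := by linarith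
  have hsA : s < A := by linarith
  have hF := FF_pos x y hsA
  have k1 : kk (y-x) (A-s) ≤ Real.exp (-(y-x)^2/(4*A)) / √(π * (A-T)) := by
    unfold kk
    have : -(y-x)^2/(4*(A-s)) ≤ -(y-x)^2/(4*A) := by
      rw [neg_div, neg_div, neg_le_neg_iff]
      gcongr
      linarith
    gcongr
  have k2 : Real.exp (-y^2/(12*A)) / √(π * (4*A)) ≤ kk y (4*A-s) := by
    unfold kk
    have h4 : 0 < 4*A - s := by linarith
    have : -y^2/(12*A) ≤ -y^2/(4*(4*A-s)) := by
      rw [neg_div, neg_div, neg_le_neg_iff]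
      exact div_le_div_of_nonneg_left (sq_nonneg _) (by linarith) (by linarith)
    gcongr
    linarith
  have k3 : (1 + (y+x)^2) * Real.exp (-(y-x)^2/(4*A)) ≤ D * Real.exp (-y^2/(12*A)) := by
    have e1 : -(y-x)^2/(4*A) ≤ x^2/(4*A) + -y^2/(12*A) + -(y^2/(24*A)) := by
      have : x^2/(4*A) + -y^2/(12*A) + -(y^2/(24*A)) - -(y-x)^2/(4*A) =
        (y - 2*x)^2/(8*A) := by field_simp; ring
      have h2 : 0 ≤ (y - 2*x)^2/(8*A) := by positivity
      linarith
    have e2 : (1 + (y+x)^2) * Real.exp (-(y^2/(24*A))) ≤ 1 + 48*A + 2*x^2 := by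
      have h1 := Real.add_one_le_exp (y^2/(24*A))
      rw [Real.exp_neg, ← div_eq_mul_inv, div_le_iff₀ (Real.exp_pos _)]
      have h2 : 1 + (y+x)^2 ≤ 1 + 2*x^2 + 48*A * (y^2/(24*A)) := by
        have : 48*A * (y^2/(24*A)) = 2*y^2 := by field_simp; ring
        rw [this]
        nlinarith [sq_nonneg (y-x)]
      refine h2.trans ?_
      have h3 : 0 ≤ y^2/(24*A) := by positivity
      have h4 : 1 ≤ Real.exp (y^2/(24*A)) := Real.one_le_exp h3
      have h5 : y^2/(24*A) ≤ Real.exp (y^2/(24*A)) := by linarith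
      have h6 : 48*A * (y^2/(24*A)) ≤ 48*A * Real.exp (y^2/(24*A)) := by gcongr
      have h7 : (1 + 2*x^2) * 1 ≤ (1+2*x^2) * Real.exp (y^2/(24*A)) := by gcongr
      nlinarith
    calc (1 + (y+x)^2) * Real.exp (-(y-x)^2/(4*A))
        ≤ (1 + (y+x)^2) * Real.exp (x^2/(4*A) + -y^2/(12*A) + -(y^2/(24*A))) := by gcongr
      _ = ((1 + (y+x)^2) * Real.exp (-(y^2/(24*A)))) * (Real.exp (x^2/(4*A)) * Real.exp (-y^2/(12*A))) := by
          rw [Real.exp_add, Real.exp_add]; ring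
      _ ≤ (1 + 48*A + 2*x^2) * (Real.exp (x^2/(4*A)) * Real.exp (-y^2/(12*A))) := by gcongr
      _ = D * Real.exp (-y^2/(12*A)) := by rw [hD]; ring
  have hFk : FF x A s y ≤ kk (y-x) (A-s) := by
    have : kk (y+x) (A-s) ≤ kk (y-x) (A-s) := kk_anti hτ (by
      rw [abs_of_nonneg (by linarith : 0 ≤ y + x), abs_le]
      constructor <;> linarith)
    unfold FF; linarith
  have k4 : (1 + (y+x)^2) * FF x A s y ≤ K * kk y (4*A-s) := by
    calc (1 + (y+x)^2) * FF x A s y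
        ≤ (1 + (y+x)^2) * (Real.exp (-(y-x)^2/(4*A)) / √(π * (A-T))) := by
          gcongr; exact hFk.trans k1
      _ = ((1 + (y+x)^2) * Real.exp (-(y-x)^2/(4*A))) / √(π * (A-T)) := by ring
      _ ≤ (D * Real.exp (-y^2/(12*A))) / √(π * (A-T)) := by gcongr
      _ = K * (Real.exp (-y^2/(12*A)) / √(π * (4*A))) := by
          have : 0 < √(π * (4*A)) := by positivity
          rw [hK]; field_simp
      _ ≤ K * kk y (4*A-s) := by gcongr
  have hkk := kk_nonneg y (4*A-s)
  have hKk : 0 ≤ K * kk y (4*A-s) := by positivity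
  have hsqF : 0 ≤ (y+x)^2 * FF x A s y := by positivity
  have hfr : 0 ≤ 6/(4*(A-T)^2) := by positivity
  constructor
  · nlinarith
  · have hy1 : |FFy x A s y| ≤ (y+x)/(2*(A-T)) * FF x A s y := by
      have p1 := kk_pos (y-x) hτ
      have p2 := kk_pos (y+x) hτ
      have a1 : |(y-x)/(2*(A-s))| ≤ (y+x)/(2*(A-T)) := by
        rw [abs_div, abs_of_pos (by positivity : 0 < 2*(A-s))]
        have : |y-x| ≤ y+x := by rw [abs_le]; constructor <;> linarith
        gcongr
      have a2 : |(y+x)/(2*(A-s))| ≤ (y+x)/(2*(A-T)) := by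
        rw [abs_div, abs_of_pos (by positivity : 0 < 2*(A-s)),
          abs_of_nonneg (by linarith : 0 ≤ y + x)]
        gcongr
      unfold FFy FF
      rw [abs_div, abs_two]
      have : |-((y-x)/(2*(A-s))) * kk (y-x) (A-s) + -((y+x)/(2*(A-s))) * kk (y+x) (A-s)| ≤
          (y+x)/(2*(A-T)) * kk (y-x) (A-s) + (y+x)/(2*(A-T)) * kk (y+x) (A-s) := by
        refine (abs_add_le _ _).trans ?_
        rw [abs_mul, abs_mul, abs_neg, abs_neg, abs_of_pos p1, abs_of_pos p2]
        gcongr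
      linarith
    have hy2 : (FFy x A s y)^2 ≤ ((y+x)/(2*(A-T)) * FF x A s y)^2 := by
      rw [← sq_abs (FFy x A s y)]
      gcongr
    calc 6 / FF x A s y * (FFy x A s y)^2 ≤ 6 / FF x A s y * ((y+x)/(2*(A-T)) * FF x A s y)^2 := by
          gcongr
      _ = 6/(4*(A-T)^2) * ((y+x)^2 * FF x A s y) := by field_simp; ring
      _ ≤ 6/(4*(A-T)^2) * (K * kk y (4*A-s)) := by
          refine mul_le_mul_of_nonneg_left ?_ hfr
          linarith
      _ ≤ (1 + 6/(4*(A-T)^2)) * K * kk y (4*A-s) := by nlinarith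

lemma Sol.repA {ℓ : ℝ} {u : ℝ → ℝ → ℝ} {f : ℝ → ℝ} (h : Sol ℓ u f) {x A T : ℝ}
    (hx : 0 ≤ x) (hT : 0 < T) (hTA : T < A) :
    IntegrableOn (fun y => FF x A T y * u T y) (Ioi 0) ∧
    (∫ y in Ioi (0:ℝ), FF x A T y * u T y) + (∫ s in Ioc 0 T, f s * kk x (A - s))
      = ℓ * kk x A := by
  have hA : 0 < A := hT.trans hTA
  obtain ⟨C, hC0, hC⟩ := FF_dom hx hT hTA
  obtain ⟨B, hB0, hB⟩ := h.gauss (T := 4*A) (by linarith)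
  set ε : ℕ → ℝ := fun n => 1 / ((n:ℝ)+1) with hε
  have hε0 : ∀ n, 0 < ε n := fun n => by simp only [hε]; positivity
  have hεt : Tendsto ε atTop (𝓝 0) := delta_tendsto
  have adm := fun n => JJ_adm (ε := ε n) (x := x) (A := A) (hε0 n) hx
  have hBi : ∀ s, 0 < s → s ≤ T → IntegrableOn (fun y => C * kk y (4*A-s) * u s y) (Ioi 0) :=
    fun s h0 h1 => by
      have : IntegrableOn (fun y => C * (kk y (4*A-s) * u s y)) (Ioi 0) :=
        ((hB s h0 (by linarith)).1).const_mul C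
      refine this.congr_fun (fun y _ => ?_) measurableSet_Ioi
      simp only; ring
  have hJt : ∀ y, Tendsto (fun n => JJ (ε n) (FF x A T y) * u T y) atTop (𝓝 (FF x A T y * u T y)) :=
    fun y => (JJ_tendsto (FF_pos x y hTA) hεt tendsto_const_nhds).mul_const _
  have hJi : ∀ n, IntegrableOn (fun y => JJ (ε n) (FF x A T y) * u T y) (Ioi 0) := fun n =>
    int_y hT hTA h.cont (adm n).smooth.continuousOn (adm n).supp
  have L1 : Tendsto (fun n => ∫ y in Ioi (0:ℝ), JJ (ε n) (FF x A T y) * u T y) atTop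
      (𝓝 (∫ y in Ioi (0:ℝ), FF x A T y * u T y)) := by
    refine tendsto_integral_of_dominated_convergence (fun y => C * kk y (4*A-T) * u T y)
      (fun n => (hJi n).aestronglyMeasurable) (hBi T hT le_rfl) ?_ (Eventually.of_forall hJt)
    intro n
    filter_upwards [ae_restrict_mem measurableSet_Ioi] with y hy
    have hu := h.nn T y hT (le_of_lt hy)
    rw [Real.norm_of_nonneg (mul_nonneg (JJ_nonneg _ _) hu)]
    gcongr
    exact (JJ_le (hε0 n).le (FF_pos x y hTA)).trans (hC T hT le_rfl y (le_of_lt hy)).1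
  have hFi : IntegrableOn (fun y => FF x A T y * u T y) (Ioi 0) := by
    refine (hBi T hT le_rfl).mono' (aestronglyMeasurable_of_tendsto_ae atTop
      (fun n => (hJi n).aestronglyMeasurable) (Eventually.of_forall hJt)) ?_
    filter_upwards [ae_restrict_mem measurableSet_Ioi] with y hy
    have hu := h.nn T y hT (le_of_lt hy)
    rw [Real.norm_of_nonneg (mul_nonneg (FF_pos x y hTA).le hu)]
    gcongr
    exact (hC T hT le_rfl y (le_of_lt hy)).1
  refine ⟨hFi, ?_⟩
  have L2 : Tendsto (fun n => ∫ s in Ioc 0 T, f s * JJ (ε n) (kk x (A - s))) atTop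
      (𝓝 (∫ s in Ioc 0 T, f s * kk x (A - s))) := by
    have hcs : ∀ n, ContinuousOn (fun s => JJ (ε n) (kk x (A-s))) (Icc 0 T) := fun n => by
      have := ((adm n).smooth.continuousOn).comp (f := fun s : ℝ => (s, (0:ℝ))) (s := Icc 0 T)
        (by fun_prop) (fun s hs => ⟨lt_of_le_of_lt hs.2 hTA, trivial⟩)
      refine this.congr fun s hs => ?_
      simp [FF_zero]
    have hfI : IntegrableOn f (Icc 0 T) := by
      rw [integrableOn_Icc_iff_integrableOn_Ioc]; exact h.fint T
    refine tendsto_integral_of_dominated_convergence (fun s => f s * kk 0 (A-T))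
      (fun n => ((hfI.mul_continuousOn (hcs n) isCompact_Icc).mono_set
        Ioc_subset_Icc_self).aestronglyMeasurable) ((h.fint T).mul_const _) ?_ ?_
    · intro n
      filter_upwards [ae_restrict_mem measurableSet_Ioc] with s hs
      have hf := h.fnn s hs.1
      have hAs : 0 < A - s := by have := hs.2; linarith
      rw [Real.norm_of_nonneg (mul_nonneg hf (JJ_nonneg _ _))]
      gcongr
      refine (JJ_le (hε0 n).le (kk_pos x hAs)).trans ((kk_le_zero _ _).trans
        (kk_anti_t (by linarith) (by have := hs.2; linarith)))
    · filter_upwards [ae_restrict_mem measurableSet_Ioc] with s hs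
      have hAs : 0 < A - s := by have := hs.2; linarith
      exact (JJ_tendsto (kk_pos x hAs) hεt tendsto_const_nhds).const_mul _
  have L3 : Tendsto (fun n => ∫ s in Ioc 0 T, ∫ y in Ioi (0:ℝ),
      JJ2 (ε n) (FF x A s y) * (FFy x A s y)^2 * u s y) atTop (𝓝 0) := by
    have hbd : ∀ n, ∀ s ∈ Ioc 0 T, ∀ y ∈ Ioi (0:ℝ),
        ‖JJ2 (ε n) (FF x A s y) * (FFy x A s y)^2 * u s y‖ ≤ C * kk y (4*A-s) * u s y := by
      intro n s hs y hy
      have hsA : s < A := lt_of_le_of_lt hs.2 hTA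
      have hu := h.nn s y hs.1 (le_of_lt hy)
      rw [Real.norm_of_nonneg (mul_nonneg (mul_nonneg (JJ2_nonneg _ _) (sq_nonneg _)) hu)]
      refine mul_le_mul_of_nonneg_right ?_ hu
      refine le_trans ?_ (hC s hs.1 hs.2 y (le_of_lt hy)).2
      refine mul_le_mul_of_nonneg_right ?_ (sq_nonneg _)
      exact JJ2_le (hε0 n).le (FF_pos x y hsA)
    have z : (∫ s in Ioc 0 T, (0:ℝ)) = 0 := by simp
    refine Tendsto.mono_right ?_ (le_of_eq (congrArg 𝓝 z))
    refine tendsto_integral_of_dominated_convergence (fun _ => C * B) ?_ ?_ ?_ ?_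
    · intro n
      have := (adm n).ints hTA h.loc
      refine Integrable.aestronglyMeasurable (IntegrableOn.congr_fun this (fun r _ => ?_) measurableSet_Ioc)
      congr 1
      funext y
      ring
    · exact integrable_const _
    · intro n
      filter_upwards [ae_restrict_mem measurableSet_Ioc] with s hs
      refine (norm_integral_le_of_norm_le (hBi s hs.1 hs.2) ?_).trans ?_
      · filter_upwards [ae_restrict_mem measurableSet_Ioi] with y hy using hbd n s hs y hy
      · have : ∫ y in Ioi (0:ℝ), C * kk y (4*A-s) * u s y = C * ∫ y in Ioi (0:ℝ), kk y (4*A-s) * u s y := by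
          rw [← integral_const_mul]
          congr 1
          funext y; ring
        rw [this]
        exact mul_le_mul_of_nonneg_left (hB s hs.1 (by have := hs.2; linarith)).2 hC0
    · filter_upwards [ae_restrict_mem measurableSet_Ioc] with s hs
      have hsA : s < A := lt_of_le_of_lt hs.2 hTA
      have z2 : (∫ y in Ioi (0:ℝ), (0:ℝ)) = 0 := by simp
      refine Tendsto.mono_right ?_ (le_of_eq (congrArg 𝓝 z2))
      refine tendsto_integral_of_dominated_convergence (fun y => C * kk y (4*A-s) * u s y) ?_
        (hBi s hs.1 hs.2) ?_ ?_
      · intro n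
        have := (adm n).inty hs.1 hsA h.cont
        refine Integrable.aestronglyMeasurable (IntegrableOn.congr_fun this (fun r _ => ?_) measurableSet_Ioi)
        ring
      · intro n
        filter_upwards [ae_restrict_mem measurableSet_Ioi] with y hy using hbd n s hs y hy
      · refine Eventually.of_forall fun y => ?_
        have := ((JJ2_tendsto (FF x A s y) hεt).mul_const ((FFy x A s y)^2)).mul_const (u s y)
        simpa using this
  have L4 : Tendsto (fun n => ℓ * JJ (ε n) (kk x A)) atTop (𝓝 (ℓ * kk x A)) :=
    (JJ_tendsto (kk_pos x hA) hεt tendsto_const_nhds).const_mul _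
  have hl := L1.add L2
  have hr := L4.add L3
  rw [add_zero] at hr
  refine tendsto_nhds_unique hl (hr.congr fun n => ?_)
  exact (h.trunc (hε0 n) hx hT hTA).symm


lemma kk_scale (c z : ℝ) (hc : 0 < c) :
    kk z (1/(c^2+1)) / 2 = √(c^2+1) / c * (c * (kk (c * z) 1 / 2) * Real.exp (-z^2/4)) := by
  unfold kk
  have e1 : -z^2/(4*(1/(c^2+1))) = -(c*z)^2/(4*1) + -z^2/4 := by field_simp; ring
  have e2 : √(π * (1/(c^2+1))) = √(π * 1) / √(c^2+1) := by
    rw [← Real.sqrt_div (by positivity)]; congr 1; ring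
  have h1 : 0 < √(π * 1) := by positivity
  have h2 : 0 < √(c^2+1) := by positivity
  rw [e1, e2, Real.exp_add]
  field_simp

lemma even_int {g : ℝ → ℝ} (h : IntegrableOn g (Ioi 0)) (h' : IntegrableOn (fun y => g (-y)) (Ioi 0)) :
    Integrable g ∧ ∫ y, g y = ∫ y in Ioi (0:ℝ), (g y + g (-y)) := by
  have h1 : IntegrableOn g (Iic 0) := by
    rw [integrableOn_Iic_iff_integrableOn_Iio]
    have h3 := IntegrableOn.comp_neg_Iio (c := (0:ℝ)) (f := fun y => g (-y)) (by rw [neg_zero]; exact h')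
    simpa only [neg_neg] using h3
  have h2 : Integrable g := by
    rw [← integrableOn_univ, ← Iic_union_Ioi (a := (0:ℝ))]; exact h1.union h
  refine ⟨h2, ?_⟩
  rw [← intervalIntegral.integral_Iic_add_Ioi h1 h, integral_add h h', integral_comp_neg_Ioi, neg_zero, add_comm]

lemma kk_cob : Tendsto (fun z : ℝ => ‖z‖ ^ (Module.finrank ℝ ℝ) * (kk z 1 / 2))
    (Bornology.cobounded ℝ) (𝓝 0) := by
  rw [Module.finrank_self]
  have h1 : ∀ z : ℝ, z ≠ 0 → ‖z‖^1 * (kk z 1 / 2) ≤ 2 * ‖z‖⁻¹ := by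
    intro z hz
    have hz' : 0 < ‖z‖ := norm_pos_iff.2 hz
    have hz2 : ‖z‖^2 = z^2 := by rw [Real.norm_eq_abs, sq_abs]
    have a1 : Real.exp (-z^2/(4*1)) ≤ 4/z^2 := by
      have := Real.add_one_le_exp (z^2/4)
      have hzz : 0 < z^2 := by positivity
      have e : -z^2/(4*1) = -(z^2/4) := by ring
      rw [e, Real.exp_neg, inv_le_comm₀ (Real.exp_pos _) (by positivity), inv_div]
      linarith
    have a2 : 1 ≤ √(π * 1) := by rw [Real.one_le_sqrt]; linarith [Real.pi_gt_three]
    have a3 : kk z 1 ≤ 4 / z^2 := by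
      unfold kk
      rw [div_le_iff₀ (by positivity)]
      have : 0 ≤ 4/z^2 := by positivity
      nlinarith
    calc ‖z‖^1 * (kk z 1 / 2) ≤ ‖z‖^1 * (4/z^2/2) := by gcongr
      _ = 2 * ‖z‖⁻¹ := by rw [← hz2]; field_simp; norm_num
  have h2 : Tendsto (fun z : ℝ => 2 * ‖z‖⁻¹) (Bornology.cobounded ℝ) (𝓝 0) := by
    have := (tendsto_inv_atTop_zero.comp (tendsto_norm_cobounded_atTop (E := ℝ))).const_mul 2
    simpa using this
  refine squeeze_zero' (Eventually.of_forall fun z => ?_) ?_ h2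
  · have := kk_nonneg z 1
    positivity
  · have : ∀ᶠ z : ℝ in Bornology.cobounded ℝ, z ≠ 0 := by
      filter_upwards [(tendsto_norm_cobounded_atTop (E := ℝ)).eventually_gt_atTop 0] with z hz
      exact norm_pos_iff.1 hz
    filter_upwards [this] with z hz using h1 z hz

lemma kk_int_one : ∫ z, kk z 1 / 2 = 1 := by
  have h0 := kk_x_int one_pos
  have h1 : IntegrableOn (fun z => kk z 1 / 2) (Ioi 0) := h0.div_const 2
  have h2 : IntegrableOn (fun z => kk (-z) 1 / 2) (Ioi 0) := by simpa only [kk_neg] using h1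
  rw [(even_int (g := fun z => kk z 1 / 2) h1 h2).2]
  refine Eq.trans ?_ (kk_x_integral one_pos)
  congr 1
  funext y
  rw [kk_neg]; ring

lemma Sol.rep {ℓ : ℝ} {u : ℝ → ℝ → ℝ} {f : ℝ → ℝ} (h : Sol ℓ u f) {x T : ℝ}
    (hx : 0 ≤ x) (hT : 0 < T) :
    u T x + (∫ s in Ioc 0 T, f s * kk x (T - s)) = ℓ * kk x T := by
  set w : ℝ → ℝ := fun y => u T |y| with hw
  have hwc : Continuous w := by
    have : ContinuousOn (u T) (Ici 0) := h.cont_slice hT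
    exact this.comp_continuous continuous_abs fun y => abs_nonneg y
  have hwn : ∀ y, 0 ≤ w y := fun y => h.nn T _ hT (abs_nonneg y)
  -- integrals of the even extension
  have hK : ∀ δ : ℝ, 0 < δ → Integrable (fun y => kk (y - x) δ * w y) ∧
      ∫ y, kk (y - x) δ * w y = 2 * ∫ y in Ioi (0:ℝ), FF x (T+δ) T y * u T y := by
    intro δ hδ
    have hi := (h.repA hx hT (by linarith : T < T + δ)).1
    have meas : ∀ σ : ℝ, AEStronglyMeasurable (fun y => kk (y + σ) δ * w y) (volume.restrict (Ioi 0)) :=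
      fun σ => (((kk_cont_x δ).comp (continuous_id.add continuous_const)).mul
        hwc).aestronglyMeasurable
    have g1 : IntegrableOn (fun y => kk (y - x) δ * w y) (Ioi 0) := by
      refine (hi.const_mul 2).mono' (by simpa [sub_eq_add_neg] using meas (-x)) ?_
      filter_upwards [ae_restrict_mem measurableSet_Ioi] with y hy
      have hy0 : 0 < y := hy
      have hu := h.nn T y hT hy0.le
      have := mul_nonneg (kk_nonneg (y+x) δ) hu
      rw [Real.norm_of_nonneg (mul_nonneg (kk_nonneg _ _) (hwn y))]
      simp only [hw, abs_of_pos hy0, FF, add_sub_cancel_left]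
      linarith
    have g2 : IntegrableOn (fun y => kk (-y - x) δ * w (-y)) (Ioi 0) := by
      have e : (fun y => kk (-y - x) δ * w (-y)) = fun y => kk (y + x) δ * w y := by
        funext y
        rw [← kk_neg (y+x)]
        simp only [hw, abs_neg]
        congr 2; ring
      rw [e]
      refine (hi.const_mul 2).mono' (meas x) ?_
      filter_upwards [ae_restrict_mem measurableSet_Ioi] with y hy
      have hy0 : 0 < y := hy
      have hu := h.nn T y hT hy0.le
      have := mul_nonneg (kk_nonneg (y-x) δ) hu
      rw [Real.norm_of_nonneg (mul_nonneg (kk_nonneg _ _) (hwn y))]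
      simp only [hw, abs_of_pos hy0, FF, add_sub_cancel_left]
      linarith
    obtain ⟨e1, e2⟩ := even_int (g := fun y => kk (y - x) δ * w y) g1 g2
    refine ⟨e1, ?_⟩
    rw [e2, ← integral_const_mul]
    refine setIntegral_congr_fun measurableSet_Ioi fun y hy => ?_
    have hy0 : 0 < y := hy
    simp only [hw, abs_neg, abs_of_pos hy0, FF, add_sub_cancel_left]
    rw [← kk_neg (y+x)]
    have : -(y+x) = -y - x := by ring
    rw [this]; ring
  -- limit of the space integral
  set g : ℝ → ℝ := fun y => Real.exp (-(y-x)^2/4) * w y with hg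
  have hgi : Integrable g := by
    have := ((hK 1 one_pos).1).const_mul (√(π*1))
    refine this.congr (Eventually.of_forall fun y => ?_)
    simp only [hg, kk]
    have : 0 < √(π * 1) := by positivity
    field_simp
  have hgc : Continuous g := by fun_prop
  have hgx : g x = u T x := by simp [hg, hw, abs_of_nonneg hx]
  have hlim := tendsto_integral_comp_smul_smul_of_integrable' (μ := (volume : Measure ℝ))
    (φ := fun z : ℝ => kk z 1 / 2) (fun z => div_nonneg (kk_nonneg _ _) (by norm_num))
    kk_int_one kk_cob hgi (hgc.continuousAt (x := x))
  rw [hgx] at hlim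
  have hcn : Tendsto (fun n : ℕ => (n:ℝ) + 1) atTop atTop :=
    tendsto_atTop_add_const_right _ _ tendsto_natCast_atTop_atTop
  have hlim2 := hlim.comp hcn
  set δ : ℕ → ℝ := fun n => 1/(((n:ℝ)+1)^2+1) with hδ
  have hδ0 : ∀ n, 0 < δ n := fun n => by simp only [hδ]; positivity
  have hδt : Tendsto δ atTop (𝓝 0) := by
    refine squeeze_zero (fun n => (hδ0 n).le) (fun n => ?_) delta_tendsto
    simp only [hδ]
    have : (0:ℝ) ≤ n := n.cast_nonneg
    gcongr
    nlinarith
  have hrat : Tendsto (fun n : ℕ => √(((n:ℝ)+1)^2+1) / ((n:ℝ)+1)) atTop (𝓝 1) := by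
    have h1 : Tendsto (fun n : ℕ => √(1 + (1/((n:ℝ)+1))^2)) atTop (𝓝 (√(1 + 0^2))) :=
      (Real.continuous_sqrt.tendsto _).comp ((delta_tendsto.pow 2).const_add 1)
    have e : √(1 + 0^2) = (1:ℝ) := by simp
    rw [e] at h1
    refine h1.congr fun n => ?_
    have hn : (0:ℝ) < (n:ℝ) + 1 := by positivity
    have e2 : 1 + (1/((n:ℝ)+1))^2 = (((n:ℝ)+1)^2+1) / ((n:ℝ)+1)^2 := by field_simp
    rw [e2, Real.sqrt_div (by positivity), Real.sqrt_sq hn.le]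
  have L1 : Tendsto (fun n => ∫ y in Ioi (0:ℝ), FF x (T+δ n) T y * u T y) atTop (𝓝 (u T x)) := by
    have := hrat.mul hlim2
    rw [one_mul] at this
    refine this.congr fun n => ?_
    have e := (hK (δ n) (hδ0 n)).2
    have e2 : ∫ y in Ioi (0:ℝ), FF x (T+δ n) T y * u T y = ∫ y, kk (y-x) (δ n) / 2 * w y := by
      have : ∀ y, kk (y-x) (δ n) / 2 * w y = (kk (y-x) (δ n) * w y) / 2 := fun y => by ring
      simp_rw [this]
      rw [integral_div, e]; ring
    rw [e2, Function.comp, ← integral_const_mul]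
    congr 1
    funext y
    simp only [hδ]
    rw [kk_scale _ _ (by positivity : (0:ℝ) < (n:ℝ)+1), Module.finrank_self]
    simp only [hg, smul_eq_mul, pow_one]
    have : ((n:ℝ)+1) * (x - y) = -(((n:ℝ)+1) * (y - x)) := by ring
    rw [this, kk_neg]
    ring
  have L2 : Tendsto (fun n => ∫ s in Ioc 0 T, f s * kk x (T + δ n - s)) atTop
      (𝓝 (∫ s in Ioc 0 T, f s * kk x (T - s))) := by
    simp_rw [integral_Ioc_eq_integral_Ioo]
    refine tendsto_integral_of_dominated_convergence (fun s => f s * kk 0 (T-s)) ?_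
      ((fk_int h.fint h.fcont 0 hT).mono_set Ioo_subset_Ioc_self) ?_ ?_
    · intro n
      refine ((h.fint T).mono_set Ioo_subset_Ioc_self).aestronglyMeasurable.mul ?_
      have : Measurable (fun s : ℝ => kk x (T + δ n - s)) :=
        kk_meas.comp (measurable_const.prodMk (measurable_const.sub measurable_id))
      exact this.aestronglyMeasurable
    · intro n
      filter_upwards [ae_restrict_mem measurableSet_Ioo] with s hs
      have hf := h.fnn s hs.1
      have h1 : 0 < T - s := sub_pos.2 hs.2
      rw [Real.norm_of_nonneg (mul_nonneg hf (kk_nonneg _ _))]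
      refine mul_le_mul_of_nonneg_left ((kk_le_zero _ _).trans (kk_anti_t h1 ?_)) hf
      have := hδ0 n; linarith
    · filter_upwards [ae_restrict_mem measurableSet_Ioo] with s hs
      have h1 : 0 < T - s := sub_pos.2 hs.2
      have h2 : Tendsto (fun n => T + δ n - s) atTop (𝓝 (T - s)) := by
        simpa using (hδt.const_add T).sub_const s
      exact ((kk_hasDerivAt_t x h1).continuousAt.tendsto.comp h2).const_mul _
  have L3 : Tendsto (fun n => ℓ * kk x (T + δ n)) atTop (𝓝 (ℓ * kk x T)) := by
    have h2 : Tendsto (fun n => T + δ n) atTop (𝓝 T) := by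
        simpa using (hδt.const_add T)
    exact ((kk_hasDerivAt_t x hT).continuousAt.tendsto.comp h2).const_mul _
  refine tendsto_nhds_unique (L1.add L2) (L3.congr fun n => ?_)
  have hd := hδ0 n
  exact ((h.repA hx hT (by linarith : T < T + δ n)).2).symm


lemma subst_w {t : ℝ} (ht : 0 < t) (φ : ℝ → ENNReal) :
    ∫⁻ r in Ioo 0 t, φ r =
      ∫⁻ w in Ioi (0:ℝ), ENNReal.ofReal (2*t*w/(1+w^2)^2) * φ (t/(1+w^2)) := by
  have him : Set.image (fun w : ℝ => t/(1+w^2)) (Ioi 0) = Ioo 0 t := by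
    ext r
    constructor
    · rintro ⟨w, hw, rfl⟩
      have hw0 : (0:ℝ) < w := hw
      refine ⟨by positivity, ?_⟩
      simp only
      rw [div_lt_iff₀ (by positivity)]
      nlinarith [sq_pos_of_pos hw0, mul_pos ht (sq_pos_of_pos hw0)]
    · rintro ⟨hr0, hrt⟩
      have h1 : 0 < t/r - 1 := by rw [sub_pos, one_lt_div hr0]; exact hrt
      refine ⟨√(t/r-1), Real.sqrt_pos.2 h1, ?_⟩
      simp only
      rw [Real.sq_sqrt h1.le]
      field_simp
      ring
  have hinj : InjOn (fun w : ℝ => t/(1+w^2)) (Ioi 0) := by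
    intro a ha b hb hab
    have ha0 : (0:ℝ) < a := ha
    have hb0 : (0:ℝ) < b := hb
    simp only at hab
    rw [div_eq_div_iff (by positivity) (by positivity)] at hab
    have h2 : a^2 = b^2 := by
      have := mul_left_cancel₀ ht.ne' hab
      linarith
    exact (pow_left_inj₀ ha0.le hb0.le two_ne_zero).1 h2
  have hd : ∀ w ∈ Ioi (0:ℝ), HasDerivWithinAt (fun w : ℝ => t/(1+w^2)) (-(2*t*w/(1+w^2)^2)) (Ioi 0) w := by
    intro w hw
    have hp : (1+w^2) ≠ 0 := by positivity
    have h1 : HasDerivAt (fun w : ℝ => 1+w^2) (2*w) w := by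
      simpa using (hasDerivAt_pow 2 w).const_add 1
    refine (((hasDerivAt_const w t).fun_div h1 hp).congr_deriv ?_).hasDerivWithinAt
    ring
  have := lintegral_image_eq_lintegral_abs_deriv_mul measurableSet_Ioi hd hinj φ
  rw [him] at this
  rw [this]
  refine setLIntegral_congr_fun measurableSet_Ioi fun w hw => ?_
  have hw0 : (0:ℝ) < w := hw
  rw [abs_neg, abs_of_pos (by positivity)]

lemma sub_w {t w : ℝ} : t - t/(1+w^2) = t*w^2/(1+w^2) := by
  have hp : (1+w^2) ≠ 0 := by positivity
  field_simp
  ring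

lemma kk_w {t w : ℝ} (ht : 0 < t) (hw : 0 < w) (x : ℝ) :
    kk x (t/(1+w^2)) * kk 0 (t - t/(1+w^2)) =
      Real.exp (-x^2/(4*t)) * Real.exp (-(x^2/(4*t)) * w^2) * (1+w^2) / (π * t * w) := by
  have hp : 0 < 1+w^2 := by positivity
  rw [sub_w, kk_zero]
  unfold kk
  have e1 : √(π * (t/(1+w^2))) * √(π * (t*w^2/(1+w^2))) = π * t * w / (1+w^2) := by
    rw [← Real.sqrt_mul (by positivity)]
    have : π * (t/(1+w^2)) * (π * (t*w^2/(1+w^2))) = (π * t * w / (1+w^2))^2 := by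
      field_simp
    rw [this, Real.sqrt_sq (by positivity)]
  have e2 : -x^2/(4*(t/(1+w^2))) = -x^2/(4*t) + -(x^2/(4*t)) * w^2 := by field_simp; ring
  rw [div_mul_div_comm, e1, mul_one, e2, Real.exp_add]
  field_simp

noncomputable def qq (x t : ℝ) : ℝ := x/(2*t) * kk x t

lemma qq_nonneg {x : ℝ} (hx : 0 ≤ x) (t : ℝ) : 0 ≤ qq x t := by
  unfold qq
  rcases le_or_gt t 0 with h | h
  · rw [kk_of_nonpos x h, mul_zero]
  · have := kk_nonneg x t
    positivity

noncomputable def K (x t : ℝ) : ENNReal := ENNReal.ofReal (kk x t)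
noncomputable def Q (x t : ℝ) : ENNReal := ENNReal.ofReal (qq x t)

lemma K_meas (x : ℝ) : Measurable (K x) :=
  (kk_meas.comp (measurable_const.prodMk measurable_id)).ennreal_ofReal

lemma Q_meas (x : ℝ) : Measurable (Q x) := by
  have h1 : Measurable (fun t => kk x t) := kk_meas.comp (measurable_const.prodMk measurable_id)
  unfold Q qq
  fun_prop

lemma K_of_nonpos (x : ℝ) {t : ℝ} (h : t ≤ 0) : K x t = 0 := by
  unfold K; rw [kk_of_nonpos x h]; simp

lemma Q_of_nonpos (x : ℝ) {t : ℝ} (h : t ≤ 0) : Q x t = 0 := by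
  unfold Q qq; rw [kk_of_nonpos x h]; simp

/-- causal convolution -/
lemma conv_causal {f g : ℝ → ENNReal} (hf : ∀ t ≤ 0, f t = 0) (hg : ∀ t ≤ 0, g t = 0) (t : ℝ) :
    lconvolution f g volume t = ∫⁻ s in Ioo 0 t, f s * g (t - s) := by
  rw [lconvolution_def, ← lintegral_indicator measurableSet_Ioo]
  refine lintegral_congr fun s => ?_
  by_cases hs : s ∈ Ioo 0 t
  · rw [indicator_of_mem hs, neg_add_eq_sub]
  · rw [indicator_of_notMem hs]
    rw [mem_Ioo, not_and_or] at hs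
    rcases hs with h | h
    · rw [hf s (not_lt.1 h), zero_mul]
    · rw [hg (-s + t) (by linarith [not_lt.1 h]), mul_zero]

lemma conv_neg {f g : ℝ → ENNReal} (hf : ∀ t ≤ 0, f t = 0) (hg : ∀ t ≤ 0, g t = 0) {t : ℝ}
    (ht : t ≤ 0) : lconvolution f g volume t = 0 := by
  rw [conv_causal hf hg, Ioo_eq_empty (by simpa using ht)]; simp

lemma Q_conv_K {x : ℝ} (hx : 0 < x) : lconvolution (Q x) (K 0) volume = K x := by
  funext t
  rcases le_or_gt t 0 with ht | ht
  · rw [conv_neg (fun t h => Q_of_nonpos x h) (fun t h => K_of_nonpos 0 h) ht, K_of_nonpos x ht]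
  rw [conv_causal (fun t h => Q_of_nonpos x h) (fun t h => K_of_nonpos 0 h), subst_w ht]
  have e : ∀ w ∈ Ioi (0:ℝ), ENNReal.ofReal (2*t*w/(1+w^2)^2) *
      (Q x (t/(1+w^2)) * K 0 (t - t/(1+w^2))) =
      ENNReal.ofReal (x/(π*t) * Real.exp (-x^2/(4*t)) * Real.exp (-(x^2/(4*t)) * w^2)) := by
    intro w hw
    have hw0 : (0:ℝ) < w := hw
    have hp : 0 < 1+w^2 := by positivity
    unfold Q K
    rw [← ENNReal.ofReal_mul (qq_nonneg hx.le _), ← ENNReal.ofReal_mul (by positivity)]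
    congr 1
    unfold qq
    rw [mul_assoc (x/(2*(t/(1+w^2)))), kk_w ht hw0]
    field_simp
  rw [setLIntegral_congr_fun measurableSet_Ioi e, ← ofReal_integral_eq_lintegral_ofReal]
  · rw [integral_const_mul, integral_gaussian_Ioi]
    unfold K kk
    congr 1
    have e1 : √(π/(x^2/(4*t))) = 2 * √(π*t) / x := by
      have : π/(x^2/(4*t)) = (2/x)^2 * (π*t) := by field_simp; ring
      rw [this, Real.sqrt_mul (by positivity), Real.sqrt_sq (by positivity)]; ring
    have e2 : √(π*t) * √(π*t) = π*t := Real.mul_self_sqrt (by positivity)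
    have h0 : 0 < √(π*t) := by positivity
    rw [e1, eq_div_iff h0.ne']
    have h3 : x / (π * t) * rexp (-x ^ 2 / (4 * t)) * (2 * √(π * t) / x / 2) * √(π * t) =
      x / (π * t) * rexp (-x ^ 2 / (4 * t)) * (√(π * t) * √(π * t)) / x := by ring
    rw [h3, e2]
    field_simp
  · exact ((integrable_exp_neg_mul_sq (by positivity)).const_mul _).integrableOn
  · exact Eventually.of_forall fun w => by simp only [Pi.zero_apply]; positivity

lemma K_conv_K {t : ℝ} (ht : 0 < t) : lconvolution (K 0) (K 0) volume t = 1 := by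
  rw [conv_causal (fun t h => K_of_nonpos 0 h) (fun t h => K_of_nonpos 0 h), subst_w ht]
  have e : ∀ w ∈ Ioi (0:ℝ), ENNReal.ofReal (2*t*w/(1+w^2)^2) *
      (K 0 (t/(1+w^2)) * K 0 (t - t/(1+w^2))) =
      ENNReal.ofReal (2/π * (1+w^2)⁻¹) := by
    intro w hw
    have hw0 : (0:ℝ) < w := hw
    have hp : 0 < 1+w^2 := by positivity
    unfold K
    rw [← ENNReal.ofReal_mul (kk_nonneg _ _), ← ENNReal.ofReal_mul (by positivity)]
    congr 1
    rw [kk_w ht hw0]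
    simp
    field_simp
  rw [setLIntegral_congr_fun measurableSet_Ioi e, ← ofReal_integral_eq_lintegral_ofReal]
  · rw [integral_const_mul, integral_Ioi_inv_one_add_sq]
    simp
  · exact (integrable_inv_one_add_sq.const_mul _).integrableOn
  · exact Eventually.of_forall fun w => by simp only [Pi.zero_apply]; positivity


/-- extension by zero, as an extended nonnegative function -/
noncomputable def extz (f : ℝ → ℝ) (t : ℝ) : ENNReal := ENNReal.ofReal (indicator (Ioi 0) f t)

lemma extz_pos (f : ℝ → ℝ) {t : ℝ} (ht : 0 < t) : extz f t = ENNReal.ofReal (f t) := by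
  unfold extz; rw [indicator_of_mem (by simpa using ht)]

lemma extz_nonpos (f : ℝ → ℝ) {t : ℝ} (ht : t ≤ 0) : extz f t = 0 := by
  unfold extz; rw [indicator_of_notMem (by simpa using ht)]; simp

lemma extz_meas {f : ℝ → ℝ} (hf : ContinuousOn f (Ioi 0)) : Measurable (extz f) := by
  unfold extz
  refine Measurable.ennreal_ofReal ?_
  have := (hf.measurable_piecewise (g := fun _ => (0:ℝ)) continuousOn_const measurableSet_Ioi)
  rw [← Set.piecewise_eq_indicator]
  exact this

lemma ext_conv_K {f : ℝ → ℝ} (hfi : ∀ T, IntegrableOn f (Ioc 0 T)) (hfc : ContinuousOn f (Ioi 0))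
    (hfn : ∀ t, 0 < t → 0 ≤ f t) (x : ℝ) {t : ℝ} (ht : 0 < t) :
    lconvolution (extz f) (K x) volume t =
      ENNReal.ofReal (∫ s in Ioc 0 t, f s * kk x (t - s)) := by
  rw [conv_causal (fun t h => extz_nonpos f h) (fun t h => K_of_nonpos x h),
    restrict_Ioo_eq_restrict_Ioc,
    ofReal_integral_eq_lintegral_ofReal (fk_int hfi hfc x ht)]
  · refine setLIntegral_congr_fun measurableSet_Ioc fun s hs => ?_
    rw [extz_pos f hs.1, K, ENNReal.ofReal_mul (hfn s hs.1)]
  · refine (ae_restrict_iff' measurableSet_Ioc).2 (Eventually.of_forall fun s hs => ?_)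
    exact mul_nonneg (hfn s hs.1) (kk_nonneg _ _)

lemma conv_lin {f g1 g2 g : ℝ → ENNReal} {c : ENNReal} (hf : Measurable f) (h1 : Measurable g1)
    (hg : Measurable g)
    (h : ∀ s, g1 s + g2 s = c * g s) (t : ℝ) :
    lconvolution f g1 volume t + lconvolution f g2 volume t = c * lconvolution f g volume t := by
  simp only [lconvolution_def]
  rw [← lintegral_add_left (by fun_prop), ← lintegral_const_mul _ (by fun_prop)]
  refine lintegral_congr fun s => ?_
  rw [← mul_add, h]; ring

structure Vol (p ℓ : ℝ) (h : ℝ → ℝ) : Prop where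
  cont : ContinuousOn h (Ioi 0)
  nn : ∀ t, 0 < t → 0 ≤ h t
  fint : ∀ T, IntegrableOn (fun t => h t ^ p) (Ioc 0 T)
  eq : ∀ t, 0 < t → h t + ∫ s in Ioc 0 t, h s ^ p * kk 0 (t - s) = ℓ * kk 0 t

lemma Vol.fcont {p ℓ : ℝ} {h : ℝ → ℝ} (H : Vol p ℓ h) (hp : 0 ≤ p) :
    ContinuousOn (fun t => h t ^ p) (Ioi 0) :=
  H.cont.rpow_const fun _ _ => Or.inr hp

lemma Vol.eqE {p ℓ : ℝ} {h : ℝ → ℝ} (H : Vol p ℓ h) (hp : 0 ≤ p) (hl : 0 ≤ ℓ) (t : ℝ) :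
    extz h t + lconvolution (extz (fun t => h t ^ p)) (K 0) volume t = ENNReal.ofReal ℓ * K 0 t := by
  rcases le_or_gt t 0 with ht | ht
  · rw [conv_neg (fun t h => extz_nonpos _ h) (fun t h => K_of_nonpos 0 h) ht, K_of_nonpos 0 ht,
      extz_nonpos _ ht]; simp
  · rw [ext_conv_K H.fint (H.fcont hp) (fun t ht => Real.rpow_nonneg (H.nn t ht) p) 0 ht,
      extz_pos h ht, ← ENNReal.ofReal_add (H.nn t ht), H.eq t ht, ENNReal.ofReal_mul hl, K]
    refine setIntegral_nonneg measurableSet_Ioc fun s hs => ?_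
    exact mul_nonneg (Real.rpow_nonneg (H.nn s hs.1) p) (kk_nonneg _ _)

lemma Vol.mass {p ℓ : ℝ} {h : ℝ → ℝ} (H : Vol p ℓ h) (hp : 0 ≤ p) (hl : 0 ≤ ℓ) {t : ℝ}
    (ht : 0 < t) :
    (∫⁻ s in Ioo 0 t, K 0 s * extz h (t - s)) + (∫⁻ s in Ioo 0 t, extz (fun t => h t ^ p) s)
      = ENNReal.ofReal ℓ := by
  have hm := extz_meas H.cont
  have hfm := extz_meas (H.fcont hp)
  have h1 := conv_lin (K_meas 0) hm (K_meas 0) (H.eqE hp hl) t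
  rw [K_conv_K ht, mul_one] at h1
  rw [← h1,
    conv_causal (fun t h => K_of_nonpos 0 h) (fun t h => extz_nonpos _ h)]
  congr 1
  have e : lconvolution (extz (fun t => h t ^ p)) (K 0) volume =
    lconvolution (K 0) (extz (fun t => h t ^ p)) volume := lconvolution_comm
  rw [show lconvolution (K 0) (lconvolution (extz (fun t => h t ^ p)) (K 0) volume) volume t =
     lconvolution (extz (fun t => h t ^ p)) (lconvolution (K 0) (K 0) volume) volume t by
    rw [e, lconvolution_assoc (K_meas 0) (K_meas 0) hfm, lconvolution_comm]]
  rw [conv_causal (fun t h => extz_nonpos _ h)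
    (fun t h => conv_neg (fun t h => K_of_nonpos 0 h) (fun t h => K_of_nonpos 0 h) h)]
  refine setLIntegral_congr_fun measurableSet_Ioo fun s hs => ?_
  rw [K_conv_K (by linarith [hs.2]), mul_one]

lemma Vol.poisson {p ℓ : ℝ} {h : ℝ → ℝ} (H : Vol p ℓ h) (hp : 0 ≤ p) (hl : 0 ≤ ℓ) {t x v : ℝ}
    (ht : 0 < t) (hx : 0 < x) (hv0 : 0 ≤ v)
    (hv : v + ∫ s in Ioc 0 t, h s ^ p * kk x (t - s) = ℓ * kk x t) :
    ENNReal.ofReal v = ∫⁻ s in Ioo 0 t, Q x s * extz h (t - s) := by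
  have hm := extz_meas H.cont
  have hfm := extz_meas (H.fcont hp)
  have hfn : ∀ t, 0 < t → 0 ≤ h t ^ p := fun t ht => Real.rpow_nonneg (H.nn t ht) p
  have h1 := conv_lin (Q_meas x) hm (K_meas 0) (H.eqE hp hl) t
  rw [Q_conv_K hx,
    conv_causal (fun t h => Q_of_nonpos x h) (fun t h => extz_nonpos _ h)] at h1
  have e : lconvolution (Q x) (lconvolution (extz (fun t => h t ^ p)) (K 0) volume) volume =
    lconvolution (extz (fun t => h t ^ p)) (K x) volume := by
    rw [lconvolution_assoc (Q_meas x) hfm (K_meas 0),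
      lconvolution_comm (f := Q x), ← lconvolution_assoc hfm (Q_meas x) (K_meas 0), Q_conv_K hx]
  rw [e, ext_conv_K H.fint (H.fcont hp) hfn x ht, K, ← ENNReal.ofReal_mul hl, ← hv,
    ENNReal.ofReal_add hv0] at h1
  · exact ((ENNReal.add_left_inj ENNReal.ofReal_ne_top).1 h1).symm
  · refine setIntegral_nonneg measurableSet_Ioc fun s hs => ?_
    exact mul_nonneg (hfn s hs.1) (kk_nonneg _ _)


lemma kk_ratio {s τ t : ℝ} (hs : 0 < s) (hst : s < τ) (ht : τ ≤ t) :
    kk 0 (t - s) * kk 0 τ ≤ kk 0 (τ - s) * kk 0 t := by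
  simp only [kk_zero]
  rw [div_mul_div_comm, div_mul_div_comm, mul_one]
  have h1 : 0 < √(π * (τ - s)) := Real.sqrt_pos.2 (mul_pos pi_pos (by linarith))
  have h2 : 0 < √(π * t) := Real.sqrt_pos.2 (mul_pos pi_pos (by linarith))
  refine one_div_le_one_div_of_le (by positivity) ?_
  rw [← Real.sqrt_mul (mul_nonneg pi_pos.le (by linarith)),
    ← Real.sqrt_mul (mul_nonneg pi_pos.le (by linarith))]
  refine Real.sqrt_le_sqrt ?_
  have : (τ - s) * t ≤ (t - s) * τ := by nlinarith
  nlinarith [mul_pos pi_pos pi_pos]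

lemma kk_half {t1 t : ℝ} (h1 : 0 < t1) (h2 : t1 ≤ t) (h : t ≤ 4 * t1) : kk 0 t1 / 2 ≤ kk 0 t := by
  have e : kk 0 (4 * t1) = kk 0 t1 / 2 := by
    rw [kk_zero, kk_zero, show π * (4 * t1) = 2^2 * (π * t1) by ring,
      Real.sqrt_mul (by positivity), Real.sqrt_sq (by norm_num)]
    field_simp
  rw [← e]
  exact kk_anti_t (by linarith) h

lemma kk_shift {a b : ℝ} (hab : a ≤ b) :
    ∫ s in Ioc a b, kk 0 (b - s) = ∫ s in Ioc 0 (b - a), kk 0 s := by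
  rw [← intervalIntegral.integral_of_le hab, ← intervalIntegral.integral_of_le (by linarith),
    intervalIntegral.integral_comp_sub_left (fun s => kk 0 s) b]
  simp

lemma kk_shift_int {a b : ℝ} (hab : a ≤ b) :
    IntegrableOn (fun s => kk 0 (b - s)) (Ioc a b) := by
  have h := kk_zero_int (b - a)
  rw [← intervalIntegrable_iff_integrableOn_Ioc_of_le (by linarith)] at h
  rw [← intervalIntegrable_iff_integrableOn_Ioc_of_le hab]
  have := (h.comp_sub_left b).symm
  simpa using this

lemma volterra_step {D F : ℝ → ℝ} {c t1 t L : ℝ} (ht1 : 0 < t1)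
    (hDc : ContinuousOn D (Ioi 0)) (hFc : ContinuousOn F (Ioi 0))
    (hFi : ∀ T, IntegrableOn F (Ioc 0 T))
    (hD : ∀ t, 0 < t → D t = c * kk 0 t - ∫ s in Ioc 0 t, F s * kk 0 (t - s))
    (hF : ∀ s ∈ Ioo 0 t1, 0 ≤ F s) (hD1 : 0 ≤ D t1) (htt : t1 ≤ t) (ht4 : t ≤ 4 * t1)
    (hL0 : 0 ≤ L) (hLip : ∀ s ∈ Icc t1 t, |F s| ≤ L * |D s|)
    (hL : L * ∫ s in Ioc 0 (t - t1), kk 0 s ≤ 1/8) : 0 ≤ D t := by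
  set g : ℝ → ℝ := fun τ => c * kk 0 τ - ∫ s in Ioo 0 t1, F s * kk 0 (τ - s) with hg
  have h_int : ∀ τ, t1 ≤ τ → IntegrableOn (fun s => F s * kk 0 (τ - s)) (Ioo 0 t1) := fun τ hτ =>
    (fk_int hFi hFc 0 (lt_of_lt_of_le ht1 hτ)).mono_set
      (fun s hs => ⟨hs.1, by linarith [hs.2]⟩)
  have h_int2 : ∀ τ, t1 ≤ τ → IntegrableOn (fun s => F s * kk 0 (τ - s)) (Ioc t1 τ) := fun τ hτ =>
    (fk_int hFi hFc 0 (lt_of_lt_of_le ht1 hτ)).mono_set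
      (fun s hs => ⟨ht1.trans hs.1, hs.2⟩)
  have hsplit : ∀ τ, t1 ≤ τ → D τ = g τ - ∫ s in Ioc t1 τ, F s * kk 0 (τ - s) := by
    intro τ hτ
    rw [hD τ (by linarith), ← Ioc_union_Ioc_eq_Ioc ht1.le hτ, setIntegral_union
      (Ioc_disjoint_Ioc_of_le le_rfl) measurableSet_Ioc
      ((integrableOn_Ioc_iff_integrableOn_Ioo).2 (h_int τ hτ)) (h_int2 τ hτ),
      integral_Ioc_eq_integral_Ioo]
    simp only [hg]; ring
  have hg1 : g t1 = D t1 := by rw [hsplit t1 le_rfl]; simp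
  have hmono : ∀ τ t', t1 ≤ τ → τ ≤ t' → g τ * kk 0 t' ≤ g t' * kk 0 τ := by
    intro τ t' h1 h2
    simp only [hg]
    have : ∫ s in Ioo 0 t1, F s * kk 0 (t' - s) * kk 0 τ ≤
        ∫ s in Ioo 0 t1, F s * kk 0 (τ - s) * kk 0 t' := by
      refine setIntegral_mono_on ((h_int t' (h1.trans h2)).mul_const _) ((h_int τ h1).mul_const _)
        measurableSet_Ioo fun s hs => ?_
      rw [mul_assoc, mul_assoc]
      exact mul_le_mul_of_nonneg_left (kk_ratio hs.1 (by linarith [hs.2]) h2) (hF s hs)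
    rw [integral_mul_const, integral_mul_const] at this
    linarith
  have hk1 := kk_pos 0 ht1
  have hkt := kk_pos 0 (lt_of_lt_of_le ht1 htt)
  set a := g t / kk 0 t with ha
  have hga : g t = a * kk 0 t := by rw [ha]; field_simp
  have ha0 : 0 ≤ a := by
    have := hmono t1 t le_rfl htt
    rw [hg1] at this
    have h2 : 0 ≤ g t * kk 0 t1 := le_trans (by positivity) this
    have h3 : 0 ≤ g t := nonneg_of_mul_nonneg_left h2 hk1
    positivity
  have hgle : ∀ τ ∈ Icc t1 t, |g τ| ≤ a * kk 0 t1 := by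
    intro τ hτ
    have hτ0 := kk_pos 0 (lt_of_lt_of_le ht1 hτ.1)
    have h1 := hmono t1 τ le_rfl hτ.1
    rw [hg1] at h1
    have h2 : 0 ≤ g τ * kk 0 t1 := le_trans (by positivity) h1
    have h3 : 0 ≤ g τ := nonneg_of_mul_nonneg_left h2 hk1
    rw [abs_of_nonneg h3]
    have h4 := hmono τ t hτ.1 hτ.2
    rw [hga, mul_right_comm] at h4
    have h5 := le_of_mul_le_mul_right h4 hkt
    exact h5.trans (mul_le_mul_of_nonneg_left (kk_anti_t ht1 hτ.1) ha0)
  obtain ⟨m, hm, hmax⟩ := isCompact_Icc.exists_isMaxOn (nonempty_Icc.2 htt)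
    (f := fun s => |D s|) ((hDc.mono fun s hs => lt_of_lt_of_le ht1 hs.1).abs)
  have hmax' : ∀ s ∈ Icc t1 t, |D s| ≤ |D m| := hmax
  set N := |D m| with hN
  have hN0 : 0 ≤ N := abs_nonneg _
  have hI : ∀ τ ∈ Icc t1 t, |∫ s in Ioc t1 τ, F s * kk 0 (τ - s)| ≤ N / 8 := by
    intro τ hτ
    have h1 : |∫ s in Ioc t1 τ, F s * kk 0 (τ - s)| ≤ ∫ s in Ioc t1 τ, L * N * kk 0 (τ - s) := by
      rw [← Real.norm_eq_abs]
      refine norm_integral_le_of_norm_le ((kk_shift_int hτ.1).const_mul _) ?_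
      refine (ae_restrict_iff' measurableSet_Ioc).2 (Eventually.of_forall fun s hs => ?_)
      have hs' : s ∈ Icc t1 t := ⟨hs.1.le, hs.2.trans hτ.2⟩
      rw [norm_mul, Real.norm_eq_abs, Real.norm_eq_abs, abs_of_nonneg (kk_nonneg _ _)]
      exact mul_le_mul_of_nonneg_right ((hLip s hs').trans
        (mul_le_mul_of_nonneg_left (hmax' s hs') hL0)) (kk_nonneg _ _)
    refine h1.trans ?_
    rw [integral_const_mul, kk_shift hτ.1]
    have h2 : ∫ s in Ioc 0 (τ - t1), kk 0 s ≤ ∫ s in Ioc 0 (t - t1), kk 0 s := by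
      refine setIntegral_mono_set (kk_zero_int _) (Eventually.of_forall fun s => kk_nonneg _ _) ?_
      exact (Ioc_subset_Ioc_right (by linarith [hτ.2])).eventuallyLE
    have h3 := mul_le_mul_of_nonneg_left h2 (mul_nonneg hL0 hN0)
    nlinarith
  have hNb : N ≤ 2 * (a * kk 0 t1) := by
    have h1 := hI m hm
    have h2 := hgle m hm
    have h3 : N ≤ |g m| + |∫ s in Ioc t1 m, F s * kk 0 (m - s)| := by
      rw [hN, hsplit m hm.1]; exact abs_sub _ _
    have : 0 ≤ a * kk 0 t1 := by positivity
    linarith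
  have h1 := (abs_le.1 (hI t ⟨htt, le_rfl⟩)).2
  rw [hsplit t htt, hga]
  have := mul_le_mul_of_nonneg_left (kk_half ht1 htt ht4) ha0
  nlinarith

lemma kk_int_small {e : ℝ} (he : 0 < e) :
    ∃ η > 0, ∀ r, r ≤ η → ∫ s in Ioc 0 r, kk 0 s ≤ e := by
  have h1 : ∀ r, 0 < r → ∫ s in Ioc 0 r, kk 0 s ≤ 2 * √r := by
    intro r hr
    have : ∫ s in Ioc 0 r, kk 0 s = ∫ s in Ioc 0 r, π^(-(1/2:ℝ)) * s^(-(1/2:ℝ)) :=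
      setIntegral_congr_fun measurableSet_Ioc fun s hs => kk_zero_rpow hs.1
    rw [this, integral_const_mul, ← intervalIntegral.integral_of_le hr.le,
      integral_rpow (Or.inl (by norm_num)), Real.sqrt_eq_rpow]
    have hp : π^(-(1/2:ℝ)) ≤ 1 := Real.rpow_le_one_of_one_le_of_nonpos
      (by linarith [pi_gt_three]) (by norm_num)
    rw [show (-(1/2:ℝ) + 1) = 1/2 by norm_num, Real.zero_rpow (by norm_num)]
    have hr2 : 0 ≤ r^(1/2:ℝ) := by positivity
    nlinarith
  refine ⟨(e/2)^2, by positivity, fun r hr => ?_⟩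
  rcases le_or_gt r 0 with h0 | h0
  · rw [Ioc_eq_empty (by simpa using h0)]; simpa using he.le
  · refine (h1 r h0).trans ?_
    have := Real.sqrt_le_sqrt hr
    rw [Real.sqrt_sq (by positivity)] at this
    linarith

lemma rpow_lip {p M a b : ℝ} (hp : 1 ≤ p) (ha : a ∈ Icc 0 M) (hb : b ∈ Icc 0 M) :
    |b ^ p - a ^ p| ≤ p * M ^ (p - 1) * |b - a| := by
  have := Convex.norm_image_sub_le_of_norm_hasDerivWithin_le (f := fun x : ℝ => x ^ p)
    (f' := fun x => p * x ^ (p - 1)) (s := Icc 0 M) (C := p * M ^ (p - 1)) (x := a) (y := b)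
    (fun x _ => (Real.hasDerivAt_rpow_const (Or.inr hp)).hasDerivWithinAt)
    (fun x hx => by
      rw [Real.norm_of_nonneg (mul_nonneg (by linarith) (Real.rpow_nonneg hx.1 _))]
      exact mul_le_mul_of_nonneg_left (Real.rpow_le_rpow hx.1 hx.2 (by linarith)) (by linarith))
    (convex_Icc 0 M) ha hb
  simpa [Real.norm_eq_abs] using this


lemma kk_dil {c : ℝ} (hc : 0 < c) (t : ℝ) : kk 0 (c * t) = c^(-(1/2:ℝ)) * kk 0 t := by
  rw [kk_zero, kk_zero, show π * (c * t) = c * (π * t) by ring, Real.sqrt_mul hc.le,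
    Real.rpow_neg hc.le, ← Real.sqrt_eq_rpow, one_div, one_div, mul_inv]

lemma conv_scale {f : ℝ → ℝ} {c t : ℝ} (hc : 0 < c) (ht : 0 < t) :
    ∫ s in Ioc 0 (c * t), f s * kk 0 (c * t - s) =
      c^(1/2:ℝ) * ∫ s in Ioc 0 t, f (c * s) * kk 0 (t - s) := by
  rw [← intervalIntegral.integral_of_le (by positivity), ← intervalIntegral.integral_of_le ht.le]
  have := intervalIntegral.mul_integral_comp_mul_left
    (f := fun s => f s * kk 0 (c * t - s)) (a := 0) (b := t) (c := c)
  rw [mul_zero] at this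
  rw [← this]
  have e : ∀ s, f (c * s) * kk 0 (c * t - c * s) =
      c^(-(1/2:ℝ)) * (f (c * s) * kk 0 (t - s)) := by
    intro s; rw [← mul_sub, kk_dil hc]; ring
  simp_rw [e]
  rw [intervalIntegral.integral_const_mul, ← mul_assoc]
  congr 1
  nth_rewrite 1 [← Real.rpow_one c]
  rw [← Real.rpow_add hc]; norm_num

noncomputable def BB : ℝ := ∫ s in Ioc 0 1, s^(-(3/4:ℝ)) * kk 0 (1 - s)

lemma BB_nonneg : 0 ≤ BB := setIntegral_nonneg measurableSet_Ioc fun s hs =>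
  mul_nonneg (Real.rpow_nonneg hs.1.le _) (kk_nonneg _ _)

lemma conv_pow {t : ℝ} (ht : 0 < t) :
    ∫ s in Ioc 0 t, s^(-(3/4:ℝ)) * kk 0 (t - s) = BB * t^(-(1/4:ℝ)) := by
  have := conv_scale (f := fun s => s^(-(3/4:ℝ))) ht one_pos
  rw [mul_one] at this
  rw [this]
  have e : ∫ s in Ioc 0 1, (t * s)^(-(3/4:ℝ)) * kk 0 (1 - s) =
      ∫ s in Ioc 0 1, t^(-(3/4:ℝ)) * (s^(-(3/4:ℝ)) * kk 0 (1 - s)) := by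
    refine setIntegral_congr_fun measurableSet_Ioc fun s hs => ?_
    rw [Real.mul_rpow ht.le hs.1.le]; ring
  simp only [e]
  rw [integral_const_mul, ← mul_assoc, ← Real.rpow_add ht, BB, mul_comm]
  norm_num

lemma pow34_int (T : ℝ) : IntegrableOn (fun s : ℝ => s^(-(3/4:ℝ))) (Ioc 0 T) := by
  rcases le_or_gt T 0 with h | h
  · rw [Ioc_eq_empty (by simpa using h)]; exact integrableOn_empty
  have := (intervalIntegral.intervalIntegrable_rpow' (a := 0) (b := T)
      (by norm_num : (-1:ℝ) < -(3/4)))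
  rwa [intervalIntegrable_iff_integrableOn_Ioc_of_le h.le] at this

lemma pow34_cont : ContinuousOn (fun s : ℝ => s^(-(3/4:ℝ))) (Ioi 0) :=
  continuousOn_id.rpow_const fun s hs => Or.inl (ne_of_gt hs)

lemma conv_le {f : ℝ → ℝ} {C t : ℝ} (hfi : ∀ T, IntegrableOn f (Ioc 0 T))
    (hfc : ContinuousOn f (Ioi 0)) (ht : 0 < t)
    (hf : ∀ s ∈ Ioc 0 t, f s ≤ C * s^(-(3/4:ℝ))) :
    ∫ s in Ioc 0 t, f s * kk 0 (t - s) ≤ C * BB * t^(-(1/4:ℝ)) := by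
  rw [mul_assoc, ← conv_pow ht, ← integral_const_mul]
  refine setIntegral_mono_on (fk_int hfi hfc 0 ht)
    ((fk_int pow34_int pow34_cont 0 ht).const_mul C) measurableSet_Ioc fun s hs => ?_
  rw [← mul_assoc]
  exact mul_le_mul_of_nonneg_right (hf s hs) (kk_nonneg _ _)

lemma Vol.conv_nn {p ℓ : ℝ} {h : ℝ → ℝ} (H : Vol p ℓ h) (t : ℝ) :
    0 ≤ ∫ s in Ioc 0 t, h s ^ p * kk 0 (t - s) :=
  setIntegral_nonneg measurableSet_Ioc fun s hs =>
    mul_nonneg (Real.rpow_nonneg (H.nn s hs.1) p) (kk_nonneg _ _)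

lemma Vol.le {p ℓ : ℝ} {h : ℝ → ℝ} (H : Vol p ℓ h) {t : ℝ} (ht : 0 < t) : h t ≤ ℓ * kk 0 t := by
  have := H.eq t ht
  linarith [H.conv_nn t]

lemma Vol.pow_le {p ℓ : ℝ} {h : ℝ → ℝ} (H : Vol p ℓ h) (hp1 : 1 < p) (hp2 : p ≤ 3/2)
    (hl : 0 ≤ ℓ) {t : ℝ} (ht : 0 < t) (ht1 : t ≤ 1) :
    h t ^ p ≤ (ℓ * π^(-(1/2:ℝ)))^p * t^(-(3/4:ℝ)) := by
  have h1 := Real.rpow_le_rpow (H.nn t ht) (H.le ht) (by linarith : 0 ≤ p)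
  refine h1.trans ?_
  rw [kk_zero_rpow ht, ← mul_assoc, Real.mul_rpow (by positivity) (by positivity),
    ← Real.rpow_mul ht.le]
  refine mul_le_mul_of_nonneg_left ?_ (by positivity)
  exact Real.rpow_le_rpow_of_exponent_ge ht ht1 (by linarith)

lemma Vol.near {p ℓ1 ℓ2 : ℝ} {h1 h2 : ℝ → ℝ} (H1 : Vol p ℓ1 h1) (H2 : Vol p ℓ2 h2)
    (hp1 : 1 < p) (hp2 : p ≤ 3/2) (hl1 : 0 < ℓ1) (hl : ℓ1 < ℓ2) :
    ∃ δ > 0, ∀ t, 0 < t → t ≤ δ → h1 t ≤ h2 t := by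
  set C := (ℓ2 * π^(-(1/2:ℝ)))^p * BB with hC
  have hc0 : 0 < (ℓ2 - ℓ1) * π^(-(1/2:ℝ)) := mul_pos (by linarith) (by positivity)
  have hlim : Tendsto (fun t : ℝ => C * t^(1/4:ℝ)) (𝓝 0) (𝓝 0) := by
    have h := (Real.continuousAt_rpow_const (0:ℝ) (1/4) (Or.inr (by norm_num))).tendsto.const_mul C
    simpa [Real.zero_rpow] using h
  obtain ⟨δ, hδ, hb⟩ := Metric.eventually_nhds_iff.1 (hlim.eventually_lt_const hc0)
  refine ⟨min (δ/2) 1, by positivity, fun t ht htd => ?_⟩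
  have ht1 : t ≤ 1 := htd.trans (min_le_right _ _)
  have ht2 : t < δ := by linarith [htd.trans (min_le_left _ _)]
  have hb' : C * t^(1/4:ℝ) < (ℓ2 - ℓ1) * π^(-(1/2:ℝ)) := by
    apply hb; rw [Real.dist_eq, sub_zero, abs_of_pos ht]; exact ht2
  have e1 := H1.eq t ht
  have e2 := H2.eq t ht
  have n1 := H1.conv_nn t
  have n2 := conv_le (C := (ℓ2 * π^(-(1/2:ℝ)))^p) H2.fint (H2.fcont (by linarith)) ht
    (fun s hs => H2.pow_le hp1 hp2 (by linarith) hs.1 (hs.2.trans ht1))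
  have h3 : C * t^(-(1/4:ℝ)) ≤ (ℓ2 - ℓ1) * kk 0 t := by
    rw [kk_zero_rpow ht, ← mul_assoc, show t^(-(1/4:ℝ)) = t^(1/4:ℝ) * t^(-(1/2:ℝ)) by
      rw [← Real.rpow_add ht]; norm_num, ← mul_assoc]
    exact mul_le_mul_of_nonneg_right hb'.le (by positivity)
  linarith

lemma Vol.comp {p ℓ1 ℓ2 : ℝ} {h1 h2 : ℝ → ℝ} (H1 : Vol p ℓ1 h1) (H2 : Vol p ℓ2 h2)
    (hp1 : 1 < p) (hp2 : p ≤ 3/2) (hl1 : 0 < ℓ1) (hl : ℓ1 < ℓ2) :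
    ∀ t, 0 < t → h1 t ≤ h2 t := by
  by_contra hcon
  push Not at hcon
  obtain ⟨t0, ht0, hlt0⟩ := hcon
  obtain ⟨δ, hδ, hnear⟩ := H1.near H2 hp1 hp2 hl1 hl
  set S : Set ℝ := {t | 0 < t ∧ h2 t < h1 t} with hS
  have hSn : S.Nonempty := ⟨t0, ht0, hlt0⟩
  have hSb : BddBelow S := ⟨0, fun t ht => ht.1.le⟩
  have hδS : ∀ t ∈ S, δ ≤ t := fun t ht => by
    by_contra hh
    exact absurd (hnear t ht.1 (not_le.1 hh).le) (not_le.2 ht.2)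
  set t1 := sInf S with ht1d
  have ht1 : 0 < t1 := lt_of_lt_of_le hδ (le_csInf hSn hδS)
  have hbelow : ∀ s ∈ Ioo 0 t1, h1 s ≤ h2 s := by
    intro s hs
    by_contra hh
    exact absurd (csInf_le hSb (show s ∈ S from ⟨hs.1, not_le.1 hh⟩)) (not_le.2 hs.2)
  set D : ℝ → ℝ := fun t => h2 t - h1 t with hDd
  set F : ℝ → ℝ := fun t => h2 t ^ p - h1 t ^ p with hFd
  have hp0 : 0 ≤ p := by linarith
  have hDc : ContinuousOn D (Ioi 0) := H2.cont.sub H1.cont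
  have hFc : ContinuousOn F (Ioi 0) := (H2.fcont hp0).sub (H1.fcont hp0)
  have hFi : ∀ T, IntegrableOn F (Ioc 0 T) := fun T => (H2.fint T).sub (H1.fint T)
  have hDeq : ∀ t, 0 < t → D t = (ℓ2 - ℓ1) * kk 0 t - ∫ s in Ioc 0 t, F s * kk 0 (t - s) := by
    intro t ht
    have e1 := H1.eq t ht
    have e2 := H2.eq t ht
    have : ∫ s in Ioc 0 t, F s * kk 0 (t - s) =
        (∫ s in Ioc 0 t, h2 s ^ p * kk 0 (t - s)) - ∫ s in Ioc 0 t, h1 s ^ p * kk 0 (t - s) := by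
      rw [← integral_sub (fk_int H2.fint (H2.fcont hp0) 0 ht) (fk_int H1.fint (H1.fcont hp0) 0 ht)]
      simp only [hFd, sub_mul]
    rw [this]; simp only [hDd]; linarith
  have hF : ∀ s ∈ Ioo 0 t1, 0 ≤ F s := fun s hs =>
    sub_nonneg.2 (Real.rpow_le_rpow (H1.nn s hs.1) (hbelow s hs) hp0)
  have hD1 : 0 ≤ D t1 := by
    have hc : Tendsto D (𝓝[<] t1) (𝓝 (D t1)) :=
      ((hDc.continuousAt (Ioi_mem_nhds ht1)).tendsto).mono_left nhdsWithin_le_nhds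
    refine ge_of_tendsto hc ?_
    filter_upwards [Ioo_mem_nhdsLT ht1] with s hs
    exact sub_nonneg.2 (hbelow s hs)
  set M := ℓ2 * kk 0 t1 with hM
  set L := p * M ^ (p - 1) with hLd
  have hk1 := kk_pos 0 ht1
  have hM0 : 0 ≤ M := mul_nonneg (by linarith) hk1.le
  have hL0 : 0 ≤ L := by positivity
  obtain ⟨η, hη, hsm⟩ := kk_int_small (e := 1/(8*(L+1))) (by positivity)
  obtain ⟨s, hsS, hs⟩ := exists_lt_of_csInf_lt hSn (show sInf S < t1 + min η (3*t1) by
    have : 0 < min η (3*t1) := lt_min hη (by linarith)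
    linarith)
  have hs1 : t1 ≤ s := csInf_le hSb hsS
  have m1 := min_le_left η (3*t1)
  have m2 := min_le_right η (3*t1)
  have key := volterra_step (t := s) (L := L) ht1 hDc hFc hFi hDeq hF hD1 hs1 (by linarith) hL0 ?_ ?_
  · have := hsS.2
    simp only [hDd] at key
    linarith
  · intro r hr
    have hr0 : 0 < r := lt_of_lt_of_le ht1 hr.1
    have hkr := kk_anti_t ht1 hr.1
    refine rpow_lip hp1.le ⟨H1.nn r hr0, (H1.le hr0).trans ?_⟩ ⟨H2.nn r hr0, (H2.le hr0).trans ?_⟩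
    · have := kk_pos 0 hr0
      exact mul_le_mul hl.le hkr this.le (by linarith)
    · exact mul_le_mul_of_nonneg_left hkr (by linarith)
  · have := hsm (s - t1) (by linarith)
    have h2 := mul_le_mul_of_nonneg_left this hL0
    refine h2.trans ?_
    rw [mul_one_div, div_le_div_iff₀ (by positivity) (by norm_num)]
    linarith


lemma Vol.h_int {p ℓ : ℝ} {h : ℝ → ℝ} (H : Vol p ℓ h) (T : ℝ) : IntegrableOn h (Ioc 0 T) := by
  refine Integrable.mono' ((kk_zero_int T).const_mul ℓ) ?_ ?_
  · exact (H.cont.mono fun s hs => hs.1).aestronglyMeasurable measurableSet_Ioc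
  · refine (ae_restrict_iff' measurableSet_Ioc).2 (Eventually.of_forall fun s hs => ?_)
    rw [Real.norm_of_nonneg (H.nn s hs.1)]
    exact H.le hs.1

lemma Vol.massR {p ℓ : ℝ} {h : ℝ → ℝ} (H : Vol p ℓ h) (hp : 0 ≤ p) (hl : 0 ≤ ℓ) {t : ℝ}
    (ht : 0 < t) :
    (∫ s in Ioc 0 t, h s * kk 0 (t - s)) + (∫ s in Ioc 0 t, h s ^ p) = ℓ := by
  have h1 := H.mass hp hl ht
  have hfn : ∀ t, 0 < t → 0 ≤ h t ^ p := fun t ht => Real.rpow_nonneg (H.nn t ht) p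
  have e1 : (∫⁻ s in Ioo 0 t, K 0 s * extz h (t - s)) =
      ENNReal.ofReal (∫ s in Ioc 0 t, h s * kk 0 (t - s)) := by
    rw [← ext_conv_K H.h_int H.cont H.nn 0 ht, lconvolution_comm,
      conv_causal (fun t h => K_of_nonpos 0 h) (fun t h => extz_nonpos _ h)]
  have e2 : (∫⁻ s in Ioo 0 t, extz (fun t => h t ^ p) s) =
      ENNReal.ofReal (∫ s in Ioc 0 t, h s ^ p) := by
    rw [ofReal_integral_eq_lintegral_ofReal (H.fint t), restrict_Ioo_eq_restrict_Ioc]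
    · refine setLIntegral_congr_fun measurableSet_Ioc fun s hs => ?_
      rw [extz_pos _ hs.1]
    · exact (ae_restrict_iff' measurableSet_Ioc).2 (Eventually.of_forall fun s hs => hfn s hs.1)
  have n1 : 0 ≤ ∫ s in Ioc 0 t, h s * kk 0 (t - s) :=
    setIntegral_nonneg measurableSet_Ioc fun s hs => mul_nonneg (H.nn s hs.1) (kk_nonneg _ _)
  have n2 : 0 ≤ ∫ s in Ioc 0 t, h s ^ p :=
    setIntegral_nonneg measurableSet_Ioc fun s hs => hfn s hs.1
  rw [e1, e2, ← ENNReal.ofReal_add n1 n2] at h1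
  exact (ENNReal.ofReal_eq_ofReal_iff (by linarith) hl).1 h1

noncomputable def gam (p : ℝ) : ℝ := 1 / (2 * (p - 1))

lemma gam_mul {p : ℝ} (hp1 : 1 < p) : gam p * p = gam p + 1/2 := by
  unfold gam
  have : p - 1 ≠ 0 := by linarith
  field_simp
  ring

lemma gam_ge {p : ℝ} (hp1 : 1 < p) (hp2 : p ≤ 3/2) : 1 ≤ gam p := by
  unfold gam
  rw [le_div_iff₀ (by linarith)]; linarith

lemma Vol.scale {p : ℝ} {h : ℝ → ℝ} (H : Vol p 1 h) (hp1 : 1 < p) {c : ℝ} (hc : 0 < c) :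
    Vol p (c^(gam p - 1/2)) (fun t => c^(gam p) * h (c * t)) where
  cont := by
    refine continuousOn_const.mul (H.cont.comp (by fun_prop) fun t ht => ?_)
    exact mul_pos hc ht
  nn := fun t ht => mul_nonneg (by positivity) (H.nn _ (mul_pos hc ht))
  fint := by
    intro T
    rcases le_or_gt T 0 with hT | hT
    · rw [Ioc_eq_empty (by simpa using hT)]; exact integrableOn_empty
    have h1 := H.fint (c * T)
    rw [← intervalIntegrable_iff_integrableOn_Ioc_of_le (by positivity)] at h1
    have h2 := h1.comp_mul_left (c := c)
    rw [zero_div, mul_div_cancel_left₀ _ hc.ne',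
      intervalIntegrable_iff_integrableOn_Ioc_of_le hT.le] at h2
    have h3 : IntegrableOn (fun s => (c^(gam p))^p * h (c * s) ^ p) (Ioc 0 T) :=
      h2.const_mul ((c^(gam p))^p)
    refine h3.congr_fun (fun s hs => ?_) measurableSet_Ioc
    simp only
    rw [Real.mul_rpow (by positivity) (H.nn _ (mul_pos hc hs.1))]
  eq := by
    intro t ht
    have e := H.eq (c * t) (mul_pos hc ht)
    rw [conv_scale (f := fun s => h s ^ p) hc ht, kk_dil hc] at e
    have e2 : ∫ s in Ioc 0 t, (c^(gam p) * h (c * s)) ^ p * kk 0 (t - s) =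
        c^(gam p) * (c^(1/2:ℝ) * ∫ s in Ioc 0 t, h (c * s) ^ p * kk 0 (t - s)) := by
      rw [← mul_assoc, ← Real.rpow_add hc, ← gam_mul hp1, ← integral_const_mul]
      refine setIntegral_congr_fun measurableSet_Ioc fun s hs => ?_
      rw [Real.mul_rpow (by positivity) (H.nn _ (mul_pos hc hs.1)), ← Real.rpow_mul hc.le]
      ring
    rw [e2, ← mul_add, e, sub_eq_add_neg, Real.rpow_add hc]
    ring

lemma Vol.mono_gam {p : ℝ} {h : ℝ → ℝ} (H : Vol p 1 h) (hp1 : 1 < p) (hp2 : p ≤ 3/2)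
    {s t : ℝ} (hs : 0 < s) (hst : s ≤ t) : s^(gam p) * h s ≤ t^(gam p) * h t := by
  rcases eq_or_lt_of_le hst with rfl | hlt
  · exact le_rfl
  have hc : 1 < t / s := (one_lt_div hs).2 hlt
  have hg := gam_ge hp1 hp2
  have := H.comp (H.scale hp1 (zero_lt_one.trans hc)) hp1 hp2 one_pos
    (Real.one_lt_rpow hc (by linarith)) s hs
  rw [div_mul_cancel₀ _ hs.ne', Real.div_rpow (by linarith) hs.le] at this
  have hsg : 0 < s^(gam p) := by positivity
  calc s^(gam p) * h s ≤ s^(gam p) * (t^(gam p) / s^(gam p) * h t) :=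
        mul_le_mul_of_nonneg_left this hsg.le
    _ = _ := by field_simp

lemma Vol.ex_pos {p : ℝ} {h : ℝ → ℝ} (H : Vol p 1 h) (hp1 : 1 < p) : ∃ t, 0 < t ∧ 0 < h t := by
  by_contra hcon
  push Not at hcon
  have hz : ∀ t, 0 < t → h t = 0 := fun t ht => le_antisymm (hcon t ht) (H.nn t ht)
  have e := H.eq 1 one_pos
  have : ∫ s in Ioc 0 1, h s ^ p * kk 0 (1 - s) = 0 := by
    rw [setIntegral_congr_fun (g := fun _ => (0:ℝ)) measurableSet_Ioc]
    · simp
    · intro s hs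
      simp only
      rw [hz s hs.1, Real.zero_rpow (by linarith), zero_mul]
  rw [this, hz 1 one_pos] at e
  have := kk_pos 0 one_pos
  linarith

lemma tail_pow {a t T : ℝ} (ha : 1 ≤ a) (ht : 0 < t) (hT : t ≤ T) :
    ∫ s in Ioc t T, s^(-(a + 1/2)) ≤ 2 * t^(1/2 - a) := by
  have h0 : (0:ℝ) ∉ uIcc t T := by
    rw [uIcc_of_le hT]; intro hh; linarith [hh.1]
  rw [← intervalIntegral.integral_of_le hT, integral_rpow (Or.inr ⟨by linarith, h0⟩),
    show -(a + 1/2) + 1 = 1/2 - a by ring, div_le_iff_of_neg (by linarith)]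
  have h1 : 0 ≤ T^(1/2 - a) := Real.rpow_nonneg (by linarith) _
  have h2 : 0 ≤ t^(1/2 - a) := Real.rpow_nonneg (by linarith) _
  nlinarith

lemma Vol.unbdd {p : ℝ} {h : ℝ → ℝ} (H : Vol p 1 h) (hp1 : 1 < p) (hp2 : p ≤ 3/2) (c : ℝ) :
    ∃ t, 0 < t ∧ c < t^(gam p) * h t := by
  by_contra hcon
  push Not at hcon
  obtain ⟨t0, ht0, hh0⟩ := H.ex_pos hp1
  have hg := gam_ge hp1 hp2
  have hp0 : 0 ≤ p := by linarith
  set γ := gam p with hγ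
  set κ := t0^γ * h t0 with hκ
  have hκ0 : 0 < κ := by positivity
  have hc0 : 0 < c := lt_of_lt_of_le hκ0 (hcon t0 ht0)
  have hup : ∀ s, 0 < s → h s ≤ c * s^(-γ) := by
    intro s hs
    rw [Real.rpow_neg hs.le, ← div_eq_mul_inv, le_div_iff₀ (by positivity), mul_comm]
    exact hcon s hs
  have hlow : ∀ s, t0 ≤ s → κ * s^(-γ) ≤ h s := by
    intro s hs
    have hs0 : 0 < s := lt_of_lt_of_le ht0 hs
    rw [Real.rpow_neg hs0.le, ← div_eq_mul_inv, div_le_iff₀ (by positivity), mul_comm (h s)]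
    exact H.mono_gam hp1 hp2 ht0 hs
  have h34 : ∀ s, 0 < s → h s ≤ (1 + c) * s^(-(3/4:ℝ)) := by
    intro s hs
    have hs34 : 0 < s^(-(3/4:ℝ)) := by positivity
    rcases le_or_gt s 1 with h1 | h1
    · have a1 := H.le hs
      rw [one_mul, kk_zero_rpow hs] at a1
      have a2 : π^(-(1/2:ℝ)) ≤ 1 := Real.rpow_le_one_of_one_le_of_nonpos
        (by linarith [pi_gt_three]) (by norm_num)
      have a3 : s^(-(1/2:ℝ)) ≤ s^(-(3/4:ℝ)) :=
        Real.rpow_le_rpow_of_exponent_ge hs h1 (by norm_num)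
      have a4 : 0 < s^(-(1/2:ℝ)) := by positivity
      nlinarith
    · have a1 := hup s hs
      have a3 : s^(-γ) ≤ s^(-(3/4:ℝ)) :=
        Real.rpow_le_rpow_of_exponent_le h1.le (by linarith)
      nlinarith
  set I : ℝ → ℝ := fun t => ∫ s in Ioc 0 t, h s * kk 0 (t - s) with hI
  set m : ℝ → ℝ := fun t => ∫ s in Ioc 0 t, h s ^ p with hm
  have hmass : ∀ t, 0 < t → I t + m t = 1 := fun t ht => H.massR hp0 zero_le_one ht
  have hI34 : ∀ t, 0 < t → I t ≤ (1 + c) * BB * t^(-(1/4:ℝ)) := fun t ht =>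
    conv_le H.h_int H.cont ht (fun s hs => h34 s hs.1)
  have hI0 : Tendsto (fun t : ℝ => (1 + c) * BB * t^(-(1/4:ℝ))) atTop (𝓝 0) := by
    have := (tendsto_rpow_neg_atTop (show (0:ℝ) < 1/4 by norm_num)).const_mul ((1 + c) * BB)
    simpa using this
  have htail : ∀ t T, 0 < t → t ≤ T → m T - m t ≤ 2 * c^p * t^(1/2 - γ) := by
    intro t T ht hT
    have e : m T = m t + ∫ s in Ioc t T, h s ^ p := by
      simp only [hm]
      rw [← Ioc_union_Ioc_eq_Ioc ht.le hT, setIntegral_union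
        (Ioc_disjoint_Ioc_of_le le_rfl) measurableSet_Ioc (H.fint t)
        ((H.fint T).mono_set (Ioc_subset_Ioc_left ht.le))]
    rw [e, add_sub_cancel_left]
    have b : ∫ s in Ioc t T, h s ^ p ≤ ∫ s in Ioc t T, c^p * s^(-(γ + 1/2)) := by
      refine setIntegral_mono_on ((H.fint T).mono_set (Ioc_subset_Ioc_left ht.le)) ?_
        measurableSet_Ioc fun s hs => ?_
      · refine Integrable.const_mul ?_ _
        refine IntegrableOn.mono_set (t := Icc t T) ?_ Ioc_subset_Icc_self
        refine ContinuousOn.integrableOn_Icc ?_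
        exact continuousOn_id.rpow_const fun s hs => Or.inl (by
          have := hs.1; simp only [id]; linarith)
      · have hs0 : 0 < s := ht.trans hs.1
        have := Real.rpow_le_rpow (H.nn s hs0) (hup s hs0) hp0
        rwa [Real.mul_rpow hc0.le (by positivity), ← Real.rpow_mul hs0.le, neg_mul,
          hγ, gam_mul hp1] at this
    refine b.trans ?_
    rw [integral_const_mul]
    have := mul_le_mul_of_nonneg_left (tail_pow hg ht hT) (show 0 ≤ c^p by positivity)
    linarith
  have hIup : ∀ t, 0 < t → I t ≤ 2 * c^p * t^(1/2 - γ) := by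
    intro t ht
    have hl : Tendsto (fun T : ℝ => 2 * c^p * t^(1/2 - γ) + (1 + c) * BB * T^(-(1/4:ℝ))) atTop
        (𝓝 (2 * c^p * t^(1/2 - γ) + 0)) := hI0.const_add _
    rw [add_zero] at hl
    refine ge_of_tendsto hl ?_
    filter_upwards [eventually_ge_atTop t] with T hT
    have h1 := htail t T ht hT
    have h2 := hI34 T (by linarith)
    have h3 := hmass t ht
    have h4 := hmass T (by linarith)
    linarith
  have hIlow : ∀ t, t0 < t → κ * t^(1 - γ) * kk 0 t * Real.log (t / t0) ≤ I t := by
    intro t ht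
    have ht' : 0 < t := ht0.trans ht
    have h_int := fk_int H.h_int H.cont 0 ht'
    have h1 : ∫ s in Ioo t0 t, h s * kk 0 (t - s) ≤ I t := by
      refine setIntegral_mono_set h_int ?_ ?_
      · exact (ae_restrict_iff' measurableSet_Ioc).2 (Eventually.of_forall fun s hs =>
          mul_nonneg (H.nn s hs.1) (kk_nonneg _ _))
      · exact HasSubset.Subset.eventuallyLE
          (show Ioo t0 t ⊆ Ioc 0 t from fun s hs => ⟨ht0.trans hs.1, hs.2.le⟩)
    refine le_trans ?_ h1
    rw [← integral_inv_of_pos ht0 ht', intervalIntegral.integral_of_le ht.le,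
      integral_Ioc_eq_integral_Ioo, ← integral_const_mul]
    refine setIntegral_mono_on ?_ (h_int.mono_set fun s hs => ⟨ht0.trans hs.1, hs.2.le⟩)
      measurableSet_Ioo fun s hs => ?_
    · refine Integrable.const_mul ?_ _
      refine IntegrableOn.mono_set (t := Icc t0 t) ?_ Ioo_subset_Icc_self
      refine ContinuousOn.integrableOn_Icc ?_
      exact continuousOn_id.inv₀ fun s hs => by
          have := hs.1; simp only [id]; linarith
    · have hs0 : 0 < s := ht0.trans hs.1
      have a1 : kk 0 t ≤ kk 0 (t - s) := kk_anti_t (by linarith [hs.2]) (by linarith)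
      have a2 := hlow s hs.1.le
      have a3 : t^(1 - γ) * s⁻¹ ≤ s^(-γ) := by
        have : t^(1-γ) ≤ s^(1-γ) :=
          Real.rpow_le_rpow_of_nonpos hs0 hs.2.le (by linarith)
        calc t^(1 - γ) * s⁻¹ ≤ s^(1-γ) * s⁻¹ := mul_le_mul_of_nonneg_right this (by positivity)
          _ = s^(-γ) := by
            rw [← Real.rpow_neg_one, ← Real.rpow_add hs0]; congr 1; ring
      have a4 : κ * (t^(1 - γ) * s⁻¹) ≤ h s := (mul_le_mul_of_nonneg_left a3 hκ0.le).trans a2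
      calc κ * t^(1 - γ) * kk 0 t * s⁻¹ = κ * (t^(1 - γ) * s⁻¹) * kk 0 t := by ring
        _ ≤ h s * kk 0 (t - s) := mul_le_mul a4 a1 (kk_nonneg _ _) (H.nn s hs0)
  -- contradiction
  have hfin : ∀ t, t0 < t → κ * π^(-(1/2:ℝ)) * Real.log (t / t0) ≤ 2 * c^p := by
    intro t ht
    have ht' : 0 < t := ht0.trans ht
    have h1 := (hIlow t ht).trans (hIup t ht')
    rw [kk_zero_rpow ht', show t^(1/2-γ) = t^(1 - γ) * t^(-(1/2:ℝ)) by
      rw [← Real.rpow_add ht']; congr 1; ring] at h1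
    have hpos : 0 < t^(1 - γ) * t^(-(1/2:ℝ)) := by positivity
    refine le_of_mul_le_mul_right ?_ hpos
    linarith
  have hlog : Tendsto (fun t : ℝ => κ * π^(-(1/2:ℝ)) * Real.log (t / t0)) atTop atTop :=
    (Real.tendsto_log_atTop.comp (tendsto_id.atTop_div_const ht0)).const_mul_atTop (by positivity)
  obtain ⟨t, h1, h2⟩ := ((hlog.eventually_gt_atTop (2 * c^p)).and (eventually_gt_atTop t0)).exists
  linarith [hfin t h2]

lemma Vol.lower {p : ℝ} {h : ℝ → ℝ → ℝ} (H : ∀ ℓ, 0 < ℓ → Vol p ℓ (h ℓ)) (hp1 : 1 < p)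
    (hp2 : p ≤ 3/2) {t B : ℝ} (ht : 0 < t) (hB : 0 ≤ B) :
    ∃ ℓ0, 0 < ℓ0 ∧ ∀ ℓ, ℓ0 < ℓ → ∀ r ∈ Icc (t/4) t, B ≤ h ℓ r := by
  have H1 := H 1 one_pos
  obtain ⟨τ, hτ, hb⟩ := H1.unbdd hp1 hp2 (B * t^(gam p))
  have hg := gam_ge hp1 hp2
  have hc : 0 < 4 * τ / t := by positivity
  refine ⟨(4 * τ / t)^(gam p - 1/2), by positivity, fun ℓ hl r hr => ?_⟩
  have hr0 : 0 < r := by linarith [hr.1]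
  have hlp : 0 < ℓ := lt_trans (by positivity) hl
  have h1 := (H1.scale hp1 hc).comp (H ℓ hlp) hp1 hp2 (by positivity) hl r hr0
  have hge : τ ≤ 4 * τ / t * r := by
    have := mul_le_mul_of_nonneg_left hr.1 hc.le
    calc τ = 4 * τ / t * (t/4) := by field_simp
      _ ≤ _ := this
  have h2 := H1.mono_gam hp1 hp2 hτ hge
  rw [Real.mul_rpow hc.le hr0.le] at h2
  have hrg : 0 < r^(gam p) := by positivity
  have h3 : B * t^(gam p) ≤ r^(gam p) * h ℓ r := by
    have := mul_le_mul_of_nonneg_left h1 hrg.le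
    linarith
  have h4 : r^(gam p) ≤ t^(gam p) := Real.rpow_le_rpow hr0.le hr.2 (by linarith)
  have h5 := mul_le_mul_of_nonneg_left h4 hB
  refine le_of_mul_le_mul_right ?_ hrg
  linarith

lemma qq_lower {x t : ℝ} (hx : 0 < x) (ht : 0 < t) :
    ∃ q > 0, ∀ s ∈ Icc (t/2) (3*t/4), q ≤ qq x s := by
  have hc : ContinuousOn (qq x) (Icc (t/2) (3*t/4)) := by
    unfold qq
    refine ContinuousOn.mul ?_ ((kk_cont_t x).mono fun s hs => ?_)
    · refine continuousOn_const.div (by fun_prop) fun s hs => ?_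
      have := hs.1; intro h0; linarith
    · have := hs.1
      show 0 < s
      linarith
  obtain ⟨m, hm, hmin⟩ := isCompact_Icc.exists_isMinOn (nonempty_Icc.2 (by linarith)) hc
  refine ⟨qq x m, ?_, fun s hs => hmin hs⟩
  have hm0 : 0 < m := by linarith [hm.1]
  have := kk_pos x hm0
  unfold qq; positivity

lemma sol_of {p ℓ : ℝ} {u : ℝ → ℝ → ℝ} (hp1 : 1 < p) (hs : IsWeakSolDelta p ℓ u)
    (hnn : ∀ t x : ℝ, 0 < t → 0 ≤ x → 0 ≤ u t x)
    (hcont : ContinuousOn (fun q : ℝ × ℝ => u q.1 q.2) (Ioi 0 ×ˢ Ici 0)) :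
    Sol ℓ u (fun t => |u t 0| ^ (p - 1) * u t 0) := by
  have h0 : ContinuousOn (fun t => u t 0) (Ioi 0) :=
    hcont.comp (f := fun t : ℝ => ((t, 0) : ℝ × ℝ)) (by fun_prop) fun t ht => ⟨ht, le_refl (0:ℝ)⟩
  exact ⟨hs.2.2.2, hs.1, hcont, (h0.abs.rpow_const fun _ _ => Or.inr (by linarith)).mul h0, hnn,
    fun t ht => mul_nonneg (by positivity) (hnn t 0 ht le_rfl)⟩

lemma rep_of {p ℓ : ℝ} {u : ℝ → ℝ → ℝ} (hp1 : 1 < p) (hs : IsWeakSolDelta p ℓ u)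
    (hnn : ∀ t x : ℝ, 0 < t → 0 ≤ x → 0 ≤ u t x)
    (hcont : ContinuousOn (fun q : ℝ × ℝ => u q.1 q.2) (Ioi 0 ×ˢ Ici 0)) {t x : ℝ}
    (ht : 0 < t) (hx : 0 ≤ x) :
    u t x + ∫ s in Ioc 0 t, u s 0 ^ p * kk x (t - s) = ℓ * kk x t := by
  rw [← (sol_of hp1 hs hnn hcont).rep hx ht]
  congr 1
  refine setIntegral_congr_fun measurableSet_Ioc fun s hs => ?_
  have := hnn s 0 hs.1 le_rfl
  rw [abs_of_nonneg this, ← Real.rpow_add_one' this (by linarith), sub_add_cancel]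

lemma vol_of {p ℓ : ℝ} {u : ℝ → ℝ → ℝ} (hp1 : 1 < p) (hs : IsWeakSolDelta p ℓ u)
    (hnn : ∀ t x : ℝ, 0 < t → 0 ≤ x → 0 ≤ u t x)
    (hcont : ContinuousOn (fun q : ℝ × ℝ => u q.1 q.2) (Ioi 0 ×ˢ Ici 0)) :
    Vol p ℓ (fun t => u t 0) where
  cont := hcont.comp (f := fun t : ℝ => ((t, 0) : ℝ × ℝ)) (by fun_prop) fun t ht => ⟨ht, le_refl (0:ℝ)⟩
  nn := fun t ht => hnn t 0 ht le_rfl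
  fint := fun T => ((sol_of hp1 hs hnn hcont).fint T).congr_fun (fun s hs => by
    have := hnn s 0 hs.1 le_rfl
    simp only
    rw [abs_of_nonneg this, ← Real.rpow_add_one' this (by linarith), sub_add_cancel])
    measurableSet_Ioc
  eq := fun t ht => rep_of hp1 hs hnn hcont ht le_rfl

theorem delta_solutions_blow_up (p : ℝ) (hp1 : 1 < p) (hp2 : p ≤ 3 / 2)
    (u : ℝ → ℝ → ℝ → ℝ)
    (hsol : ∀ ℓ : ℝ, 0 < ℓ → IsWeakSolDelta p ℓ (u ℓ))
    (hnn : ∀ ℓ : ℝ, 0 < ℓ → ∀ t x : ℝ, 0 < t → 0 ≤ x → 0 ≤ u ℓ t x)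
    (hcont : ∀ ℓ : ℝ, 0 < ℓ →
      ContinuousOn (fun q : ℝ × ℝ => u ℓ q.1 q.2) (Ioi 0 ×ˢ Ici 0)) :
    (∀ ℓ₁ ℓ₂ : ℝ, 0 < ℓ₁ → ℓ₁ ≤ ℓ₂ → ∀ t x : ℝ, 0 < t → 0 ≤ x →
        u ℓ₁ t x ≤ u ℓ₂ t x) ∧
    (∀ t x : ℝ, 0 < t → 0 ≤ x → Tendsto (fun ℓ => u ℓ t x) atTop atTop) := by
  have hp0 : 0 ≤ p := by linarith
  have V : ∀ ℓ, 0 < ℓ → Vol p ℓ (fun t => u ℓ t 0) := fun ℓ hl =>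
    vol_of hp1 (hsol ℓ hl) (hnn ℓ hl) (hcont ℓ hl)
  have P : ∀ ℓ, 0 < ℓ → ∀ t x, 0 < t → 0 < x → ENNReal.ofReal (u ℓ t x) =
      ∫⁻ s in Ioo 0 t, Q x s * extz (fun t => u ℓ t 0) (t - s) := fun ℓ hl t x ht hx =>
    (V ℓ hl).poisson hp0 hl.le ht hx (hnn ℓ hl t x ht hx.le)
      (rep_of hp1 (hsol ℓ hl) (hnn ℓ hl) (hcont ℓ hl) ht hx.le)
  refine ⟨fun ℓ₁ ℓ₂ h1 h12 t x ht hx => ?_, fun t x ht hx => ?_⟩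
  · rcases eq_or_lt_of_le h12 with rfl | hlt
    · exact le_rfl
    have h2 : 0 < ℓ₂ := h1.trans hlt
    have hc := (V ℓ₁ h1).comp (V ℓ₂ h2) hp1 hp2 h1 hlt
    rcases eq_or_lt_of_le hx with rfl | hx0
    · exact hc t ht
    refine (ENNReal.ofReal_le_ofReal_iff (hnn ℓ₂ h2 t x ht hx)).1 ?_
    rw [P ℓ₁ h1 t x ht hx0, P ℓ₂ h2 t x ht hx0]
    refine setLIntegral_mono' measurableSet_Ioo fun s hs => ?_
    have hts : 0 < t - s := by linarith [hs.2]
    rw [extz_pos _ hts, extz_pos _ hts]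
    exact mul_le_mul_right (ENNReal.ofReal_le_ofReal (hc (t - s) hts)) _
  · refine tendsto_atTop.2 fun A => ?_
    rcases eq_or_lt_of_le hx with rfl | hx0
    · obtain ⟨ℓ0, hl0, hlow⟩ := Vol.lower V hp1 hp2 ht (B := max A 0) (le_max_right _ _)
      filter_upwards [eventually_gt_atTop ℓ0] with ℓ hl
      exact (le_max_left _ _).trans (hlow ℓ hl t ⟨by linarith, le_rfl⟩)
    · obtain ⟨q, hq, hql⟩ := qq_lower hx0 ht
      have hB : 0 ≤ 4 * max A 0 / (q * t) := by positivity
      obtain ⟨ℓ0, hl0, hlow⟩ := Vol.lower V hp1 hp2 ht hB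
      filter_upwards [eventually_gt_atTop ℓ0] with ℓ hl
      have hlp : 0 < ℓ := hl0.trans hl
      refine (le_max_left A 0).trans ?_
      refine (ENNReal.ofReal_le_ofReal_iff (hnn ℓ hlp t x ht hx)).1 ?_
      rw [P ℓ hlp t x ht hx0]
      calc ENNReal.ofReal (max A 0)
          = ∫⁻ s in Ioo (t/2) (3*t/4), ENNReal.ofReal (q * (4 * max A 0 / (q * t))) := by
            rw [setLIntegral_const, Real.volume_Ioo, ← ENNReal.ofReal_mul (by positivity)]
            congr 1
            field_simp
            ring
        _ ≤ ∫⁻ s in Ioo (t/2) (3*t/4), Q x s * extz (fun t => u ℓ t 0) (t - s) := by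
            refine setLIntegral_mono' measurableSet_Ioo fun s hs => ?_
            have hts : 0 < t - s := by linarith [hs.2]
            rw [extz_pos _ hts, Q, ENNReal.ofReal_mul hq.le]
            refine mul_le_mul' (ENNReal.ofReal_le_ofReal (hql s ⟨hs.1.le, hs.2.le⟩))
              (ENNReal.ofReal_le_ofReal (hlow ℓ hl (t - s) ⟨?_, ?_⟩))
            · linarith [hs.2]
            · linarith [hs.1]
        _ ≤ _ := lintegral_mono_set (show Ioo (t/2) (3*t/4) ⊆ Ioo 0 t from
            fun s hs => ⟨by linarith [hs.1], by linarith [hs.2]⟩)
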